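/- arXiv:2103.07258 — 8 statements merged into one kernel-verified Lean document; each statement's English description precedes it below -/
import Mathlib

section
/- Every finite collection of squares whose total area is at most 8/5 can be packed into the closed unit disk: for every n ≥ 1 and all side lengths s₁, …, sₙ > 0 with s₁² + ⋯ + sₙ² ≤ 8/5, there exist isometries f₁, …, fₙ of ℝ² such that fᵢ([0,sᵢ]×[0,sᵢ]) ⊆ D for every i and the interiors of the images fᵢ([0,sᵢ]×[0,sᵢ]) are pairwise disjoint. -/
noncomputable section
open Set Metric

abbrev Plane := EuclideanSpace ℝ (Fin 2)

def unitDisk : Set Plane := closedBall 0 1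

def stdSquare (s : ℝ) : Set Plane := {p | p 0 ∈ Icc 0 s ∧ p 1 ∈ Icc 0 s}

/-- An axis-parallel square with lower left corner `(x, y)` and side length `s`. -/
structure PlacedSquare where
  x : ℝ
  y : ℝ
  s : ℝ

/-- The placed square is contained in the region `R`. -/
def PlacedSquare.In (a : PlacedSquare) (R : Set (ℝ × ℝ)) : Prop :=
  0 ≤ a.s ∧ ∀ u ∈ Icc a.x (a.x + a.s), ∀ v ∈ Icc a.y (a.y + a.s), (u, v) ∈ R

/-- Two placed squares are separated by a horizontal or a vertical line. -/
def PlacedSquare.Sep (a b : PlacedSquare) : Prop :=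
  a.x + a.s ≤ b.x ∨ b.x + b.s ≤ a.x ∨ a.y + a.s ≤ b.y ∨ b.y + b.s ≤ a.y

/-- Squares with the listed side lengths have an axis-parallel packing in `R`. -/
def Packs (R : Set (ℝ × ℝ)) (l : List ℝ) : Prop :=
  ∃ P : List PlacedSquare, P.map PlacedSquare.s = l ∧ (∀ a ∈ P, a.In R) ∧
    P.Pairwise PlacedSquare.Sep

/-- The rectangle with lower left corner `(x, y)`, width `w` and height `h`. -/
def rect (x y w h : ℝ) : Set (ℝ × ℝ) := Icc x (x + w) ×ˢ Icc y (y + h)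

/-- The part of the unit disk below height `y`. -/
def cap (y : ℝ) : Set (ℝ × ℝ) := {p | p.1 ^ 2 + p.2 ^ 2 ≤ 1 ∧ p.2 ≤ y}

/-- The total area of squares with the given side lengths. -/
def sqSum (l : List ℝ) : ℝ := (l.map (· ^ 2)).sum

/-- A nonincreasing list of positive numbers. -/
def Desc (l : List ℝ) : Prop := l.Pairwise (· ≥ ·) ∧ ∀ x ∈ l, 0 < x

lemma PlacedSquare.In.mono {a : PlacedSquare} {R R' : Set (ℝ × ℝ)} (h : a.In R) (hR : R ⊆ R') :
    a.In R' :=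
  ⟨h.1, fun u hu v hv => hR (h.2 u hu v hv)⟩

lemma Packs.mono {R R' : Set (ℝ × ℝ)} {l : List ℝ} (h : Packs R l) (hR : R ⊆ R') :
    Packs R' l := by
  obtain ⟨P, h1, h2, h3⟩ := h
  exact ⟨P, h1, fun a ha => (h2 a ha).mono hR, h3⟩

lemma packs_nil (R : Set (ℝ × ℝ)) : Packs R [] := ⟨[], by simp⟩

lemma Packs.append {R R₁ R₂ : Set (ℝ × ℝ)} {l₁ l₂ : List ℝ} (h₁ : Packs R₁ l₁) (h₂ : Packs R₂ l₂)
    (hR₁ : R₁ ⊆ R) (hR₂ : R₂ ⊆ R)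
    (hs : ∀ a b : PlacedSquare, a.In R₁ → b.In R₂ → a.Sep b) : Packs R (l₁ ++ l₂) := by
  obtain ⟨P, rfl, hP, hP'⟩ := h₁
  obtain ⟨Q, rfl, hQ, hQ'⟩ := h₂
  refine ⟨P ++ Q, by simp, ?_, List.pairwise_append.2
    ⟨hP', hQ', fun a ha b hb => hs a b (hP a ha) (hQ b hb)⟩⟩
  intro a ha
  rcases List.mem_append.1 ha with ha | ha
  exacts [(hP a ha).mono hR₁, (hQ a ha).mono hR₂]

lemma PlacedSquare.In.corner {a : PlacedSquare} {R : Set (ℝ × ℝ)} (h : a.In R) :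
    (a.x, a.y) ∈ R :=
  h.2 _ ⟨le_rfl, by linarith [h.1]⟩ _ ⟨le_rfl, by linarith [h.1]⟩

lemma PlacedSquare.In.corner' {a : PlacedSquare} {R : Set (ℝ × ℝ)} (h : a.In R) :
    (a.x + a.s, a.y + a.s) ∈ R :=
  h.2 _ ⟨by linarith [h.1], le_rfl⟩ _ ⟨by linarith [h.1], le_rfl⟩

lemma Packs.append_above {R R₁ R₂ : Set (ℝ × ℝ)} {l₁ l₂ : List ℝ} (c : ℝ)
    (h₁ : Packs R₁ l₁) (h₂ : Packs R₂ l₂) (hR₁ : R₁ ⊆ R) (hR₂ : R₂ ⊆ R)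
    (hc₁ : ∀ p ∈ R₁, c ≤ p.2) (hc₂ : ∀ p ∈ R₂, p.2 ≤ c) : Packs R (l₁ ++ l₂) :=
  h₁.append h₂ hR₁ hR₂ fun _ _ ha hb =>
    .inr (.inr (.inr ((hc₂ _ hb.corner').trans (hc₁ _ ha.corner))))

lemma Packs.append_left {R R₁ R₂ : Set (ℝ × ℝ)} {l₁ l₂ : List ℝ} (c : ℝ)
    (h₁ : Packs R₁ l₁) (h₂ : Packs R₂ l₂) (hR₁ : R₁ ⊆ R) (hR₂ : R₂ ⊆ R)
    (hc₁ : ∀ p ∈ R₁, p.1 ≤ c) (hc₂ : ∀ p ∈ R₂, c ≤ p.1) : Packs R (l₁ ++ l₂) :=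
  h₁.append h₂ hR₁ hR₂ fun _ _ ha hb =>
    .inl ((hc₁ _ ha.corner').trans (hc₂ _ hb.corner))

lemma packs_singleton {x y s : ℝ} (hs : 0 ≤ s) : Packs (rect x y s s) [s] :=
  ⟨[⟨x, y, s⟩], by simp, by
    simp only [List.mem_singleton, forall_eq]
    exact ⟨hs, fun u hu v hv => ⟨hu, hv⟩⟩, by simp⟩

lemma rect_subset {x y w h x' y' w' h' : ℝ} (h1 : x' ≤ x) (h2 : y' ≤ y) (h3 : x + w ≤ x' + w')
    (h4 : y + h ≤ y' + h') : rect x y w h ⊆ rect x' y' w' h' := by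
  rintro ⟨u, v⟩ ⟨⟨hu, hu'⟩, hv, hv'⟩
  simp only at hu hu' hv hv'
  exact ⟨⟨by linarith, by linarith⟩, by simp only; linarith, by simp only; linarith⟩

lemma packs_row (h y : ℝ) : ∀ (l : List ℝ) (x w : ℝ), (∀ s ∈ l, 0 ≤ s ∧ s ≤ h) → l.sum ≤ w →
    Packs (rect x y w h) l
  | [], _, _, _, _ => packs_nil _
  | a :: l, x, w, hl, hw => by
    have ha := hl a (by simp)
    rw [List.sum_cons] at hw
    have hsum : 0 ≤ l.sum := List.sum_nonneg fun s hs => (hl s (by simp [hs])).1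
    have ih := packs_row h y l (x + a) (w - a) (fun s hs => hl s (by simp [hs])) (by linarith)
    refine (packs_singleton (x := x) (y := y) ha.1).append_left (x + a) ih
      (rect_subset le_rfl le_rfl (by linarith) (by linarith))
      (rect_subset (by linarith) le_rfl (by linarith) le_rfl) (fun p hp => hp.1.2)
      (fun p hp => hp.1.1)

lemma exists_prefix_sum_le : ∀ (l : List ℝ) (w : ℝ), 0 ≤ w → ∃ l₁ l₂, l = l₁ ++ l₂ ∧ l₁.sum ≤ w ∧
    (l₂ = [] ∨ ∃ h t, l₂ = h :: t ∧ w < l₁.sum + h)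
  | [], w, hw => ⟨[], [], by simpa using hw⟩
  | a :: l, w, hw => by
    by_cases h : a ≤ w
    · obtain ⟨l₁, l₂, rfl, h1, h2⟩ := exists_prefix_sum_le l (w - a) (by linarith)
      refine ⟨a :: l₁, l₂, rfl, by rw [List.sum_cons]; linarith, h2.imp_right ?_⟩
      rintro ⟨b, t, rfl, hb⟩
      exact ⟨b, t, rfl, by rw [List.sum_cons]; linarith⟩
    · exact ⟨[], a :: l, rfl, by simpa using hw, .inr ⟨a, l, rfl, by simpa using h⟩⟩

@[simp] lemma sqSum_cons (a : ℝ) (l : List ℝ) : sqSum (a :: l) = a ^ 2 + sqSum l := by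
  simp [sqSum]

@[simp] lemma sqSum_nil : sqSum [] = 0 := by simp [sqSum]

lemma sqSum_append (l₁ l₂ : List ℝ) : sqSum (l₁ ++ l₂) = sqSum l₁ + sqSum l₂ := by
  simp [sqSum]

lemma sqSum_nonneg (l : List ℝ) : 0 ≤ sqSum l := by
  induction l with
  | nil => simp
  | cons a l ih => rw [sqSum_cons]; positivity

lemma mul_sum_le_sqSum {h : ℝ} : ∀ l : List ℝ, (∀ x ∈ l, 0 ≤ x ∧ h ≤ x) → h * l.sum ≤ sqSum l
  | [], _ => by simp
  | a :: l, hl => by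
    have ha := hl a (by simp)
    have ih := mul_sum_le_sqSum l fun x hx => hl x (by simp [hx])
    rw [List.sum_cons, sqSum_cons]
    nlinarith

/-- One step of greedy shelf packing: if a nonincreasing list cannot be packed into `R`, then
after filling a shelf of width `w` the remaining squares cannot be packed below the shelf. -/
lemma shelf_step {R R' : Set (ℝ × ℝ)} {x y w h : ℝ} {l : List ℝ} (hl : Desc (h :: l)) (hw : h ≤ w)
    (hR : rect x y w h ⊆ R) (hR' : R' ⊆ R) (hR'' : ∀ p ∈ R', p.2 ≤ y)
    (hf : ¬ Packs R (h :: l)) :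
    ∃ h' t, t.length < l.length ∧ 0 < h' ∧ h' ≤ h ∧ Desc (h' :: t) ∧ ¬ Packs R' (h' :: t) ∧
      h ^ 2 + h' * (w - h - h') + sqSum (h' :: t) < sqSum (h :: l) := by
  obtain ⟨hs, hp⟩ := hl
  obtain ⟨l₁, l₂, rfl, h1, h2⟩ := exists_prefix_sum_le l (w - h) (by linarith)
  rw [List.pairwise_cons] at hs
  have row : Packs (rect x y w h) (h :: l₁) := by
    refine packs_row h y _ x w (fun s hs' => ?_) (by rw [List.sum_cons]; linarith)
    refine ⟨(hp s ?_).le, ?_⟩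
    · rcases List.mem_cons.1 hs' with rfl | h <;> simp [*]
    · rcases List.mem_cons.1 hs' with rfl | h
      · exact le_rfl
      · exact hs.1 s (by simp [h])
  have key : ¬ Packs R' l₂ := fun hk =>
    hf (by simpa using row.append_above y hk hR hR' (fun p hp => hp.2.1) hR'')
  rcases h2 with rfl | ⟨h', t, rfl, h3⟩
  · exact absurd (packs_nil _) key
  · have hs2 := List.pairwise_append.1 hs.2
    refine ⟨h', t, by simp; omega, hp h' (by simp), hs.1 h' (by simp), ⟨hs2.2.1, fun x hx => hp x ?_⟩, key, ?_⟩
    · simp only [List.mem_cons, List.mem_append] at hx ⊢; tauto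
    · have := mul_sum_le_sqSum (h := h') l₁ fun x hx =>
        ⟨(hp x (by simp [hx])).le, hs2.2.2 x hx h' (by simp)⟩
      have hp' := hp h' (by simp)
      rw [sqSum_cons h, sqSum_append]
      nlinarith

lemma rect_subset_cap {y w h z : ℝ} (h1 : (w / 2) ^ 2 + y ^ 2 ≤ 1)
    (h2 : (w / 2) ^ 2 + (y + h) ^ 2 ≤ 1) (hz : y + h ≤ z) : rect (-(w / 2)) y w h ⊆ cap z := by
  rintro ⟨u, v⟩ ⟨⟨hu, hu'⟩, hv, hv'⟩
  simp only at hu hu' hv hv'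
  refine ⟨?_, by simp only; linarith⟩
  have hu2 : u ^ 2 ≤ (w / 2) ^ 2 := by nlinarith
  have hv2 : v ^ 2 ≤ y ^ 2 ∨ v ^ 2 ≤ (y + h) ^ 2 := by
    rcases le_total 0 v with h0 | h0
    · right; nlinarith
    · left; nlinarith
  simp only
  rcases hv2 with hv2 | hv2 <;> linarith

lemma cap_mono {y z : ℝ} (h : y ≤ z) : cap y ⊆ cap z := fun _ hp => ⟨hp.1, hp.2.trans h⟩

lemma cap_step {y w h : ℝ} {l : List ℝ} (hl : Desc (h :: l)) (hw : h ≤ w)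
    (h1 : (w / 2) ^ 2 + y ^ 2 ≤ 1) (h2 : (w / 2) ^ 2 + (y - h) ^ 2 ≤ 1)
    (hf : ¬ Packs (cap y) (h :: l)) :
    ∃ h' t, t.length < l.length ∧ 0 < h' ∧ h' ≤ h ∧ Desc (h' :: t) ∧
      ¬ Packs (cap (y - h)) (h' :: t) ∧
      h ^ 2 + h' * (w - h - h') + sqSum (h' :: t) < sqSum (h :: l) :=
  shelf_step hl hw (rect_subset_cap h2 (by simpa using h1) (by linarith))
    (cap_mono (by linarith [hl.2 h (by simp)])) (fun _ hp => hp.2) hf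

/-- Squares that are small compared with a rectangle can be packed into it (Moon and Moser). -/
lemma packs_rect (x y w : ℝ) (n : ℕ) : ∀ (b h : ℝ) (l : List ℝ), l.length ≤ n → Desc (h :: l) →
    h ≤ w → h ≤ b → sqSum (h :: l) ≤ h ^ 2 + (w - h) * (b - h) → Packs (rect x y w b) (h :: l) := by
  induction n with
  | zero =>
    intro b h l hn hl hw hb _
    obtain rfl : l = [] := by simpa using hn
    exact (packs_singleton (hl.2 h (by simp)).le).mono
      (rect_subset le_rfl le_rfl (by linarith) (by linarith))
  | succ n ih =>
    intro b h l hn hl hw hb hA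
    by_contra hf
    obtain ⟨h', t, h1, h2, h3, h4, h5, h6⟩ := shelf_step (R' := rect x y w (b - h))
      (x := x) (y := y + (b - h)) hl hw
      (rect_subset le_rfl (by linarith) le_rfl (by linarith))
      (rect_subset le_rfl le_rfl le_rfl (by linarith [hl.2 h (by simp)]))
      (fun p hp => hp.2.2) hf
    have hsum : h' ^ 2 ≤ sqSum (h' :: t) := by
      rw [sqSum_cons]; linarith [sqSum_nonneg t]
    have hb' : h' ≤ b - h := by
      by_contra hc
      nlinarith
    refine h5 (ih (b - h) h' t (by omega) h4 (h3.trans hw) hb' ?_)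
    nlinarith


/-- The closed unit disk in coordinates. -/
def disk : Set (ℝ × ℝ) := {p | p.1 ^ 2 + p.2 ^ 2 ≤ 1}

lemma cap_subset_disk (y : ℝ) : cap y ⊆ disk := fun _ hp => hp.1

lemma rect_subset_disk {x y w h : ℝ} (h1 : x ^ 2 + y ^ 2 ≤ 1) (h2 : x ^ 2 + (y + h) ^ 2 ≤ 1)
    (h3 : (x + w) ^ 2 + y ^ 2 ≤ 1) (h4 : (x + w) ^ 2 + (y + h) ^ 2 ≤ 1) : rect x y w h ⊆ disk := by
  rintro ⟨u, v⟩ ⟨⟨hu, hu'⟩, hv, hv'⟩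
  simp only at hu hu' hv hv'
  have hu2 : u ^ 2 ≤ x ^ 2 ∨ u ^ 2 ≤ (x + w) ^ 2 := by
    rcases le_total 0 u with h0 | h0
    · right; nlinarith
    · left; nlinarith
  have hv2 : v ^ 2 ≤ y ^ 2 ∨ v ^ 2 ≤ (y + h) ^ 2 := by
    rcases le_total 0 v with h0 | h0
    · right; nlinarith
    · left; nlinarith
  change u ^ 2 + v ^ 2 ≤ 1
  rcases hu2 with hu2 | hu2 <;> rcases hv2 with hv2 | hv2 <;> linarith

lemma PlacedSquare.Sep.symm {a b : PlacedSquare} (h : a.Sep b) : b.Sep a := by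
  unfold PlacedSquare.Sep at *; tauto

lemma disjoint_interior_of_apply_le {A B : Set Plane} (i : Fin 2) (c : ℝ) (hA : ∀ p ∈ A, p i ≤ c)
    (hB : ∀ p ∈ B, c ≤ p i) : Disjoint (interior A) (interior B) := by
  have hopen : IsOpenMap fun p : Plane => p i :=
    (EuclideanSpace.proj i : Plane →L[ℝ] ℝ).isOpenMap
      fun r => ⟨EuclideanSpace.single i r, by simp⟩
  have hcont : Continuous fun p : Plane => p i := by fun_prop
  have hA' : interior A ⊆ (fun p : Plane => p i) ⁻¹' Iio c := by
    rw [← interior_Iic, hopen.preimage_interior_eq_interior_preimage hcont]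
    exact interior_mono hA
  refine Set.disjoint_left.2 fun p hp hp' => ?_
  exact absurd (hB p (interior_subset hp')) (not_le.2 (hA' hp))

lemma image_addRight_stdSquare (x y s : ℝ) {p : Plane}
    (hp : p ∈ IsometryEquiv.addRight (!₂[x, y] : Plane) '' stdSquare s) :
    p 0 ∈ Icc x (x + s) ∧ p 1 ∈ Icc y (y + s) := by
  obtain ⟨q, ⟨⟨h1, h2⟩, h3, h4⟩, rfl⟩ := hp
  simp only [IsometryEquiv.addRight_apply, PiLp.add_apply, mem_Icc]
  simp
  refine ⟨⟨?_, ?_⟩, ?_, ?_⟩ <;> linarith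

lemma exists_isometryEquiv_of_packs {n : ℕ} {s : Fin n → ℝ} (σ : Equiv.Perm (Fin n))
    (h : Packs disk (List.ofFn fun i => s (σ i))) :
    ∃ f : Fin n → (Plane ≃ᵢ Plane),
      (∀ i, (f i) '' stdSquare (s i) ⊆ unitDisk) ∧
      (∀ i j, i ≠ j →
        Disjoint (interior ((f i) '' stdSquare (s i)))
                 (interior ((f j) '' stdSquare (s j)))) := by
  obtain ⟨P, hP, hin, hsep⟩ := h
  have hlen : P.length = n := by simpa using congrArg List.length hP
  let a : Fin n → PlacedSquare := fun i => P[(σ.symm i : ℕ)]'(by rw [hlen]; exact (σ.symm i).2)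
  have ha : ∀ i, (a i).s = s i := by
    intro i
    have h1 : (P.map PlacedSquare.s)[(σ.symm i : ℕ)]? = some (s i) := by
      rw [hP, List.getElem?_ofFn]; simp
    rw [List.getElem?_map, List.getElem?_eq_getElem (by rw [hlen]; exact (σ.symm i).2)] at h1
    simpa using h1
  have haP : ∀ i, (a i).In disk := fun i => hin _ (List.getElem_mem _)
  have hasep : ∀ i j, i ≠ j → (a i).Sep (a j) := by
    intro i j hij
    rw [List.pairwise_iff_getElem] at hsep
    have hne : (σ.symm i : ℕ) ≠ (σ.symm j : ℕ) := fun h =>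
      hij (σ.symm.injective (Fin.ext h))
    rcases lt_or_gt_of_ne hne with hlt | hlt
    · exact hsep _ _ _ _ hlt
    · exact (hsep _ _ _ _ hlt).symm
  refine ⟨fun i => IsometryEquiv.addRight (!₂[(a i).x, (a i).y] : Plane), fun i p hp => ?_,
    fun i j hij => ?_⟩
  · have hp' := image_addRight_stdSquare _ _ _ hp
    rw [← ha] at hp'
    have h1 : p 0 ^ 2 + p 1 ^ 2 ≤ 1 := (haP i).2 _ hp'.1 _ hp'.2
    rw [unitDisk, mem_closedBall, dist_zero_right, EuclideanSpace.norm_eq,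
      Real.sqrt_le_left zero_le_one]
    simpa using h1
  · rcases hasep i j hij with h | h | h | h
    · rw [ha] at h
      exact disjoint_interior_of_apply_le 0 _ (fun p hp => (image_addRight_stdSquare _ _ _ hp).1.2)
        fun p hp => h.trans (image_addRight_stdSquare _ _ _ hp).1.1
    · rw [ha] at h
      exact (disjoint_interior_of_apply_le 0 _
        (fun p hp => (image_addRight_stdSquare _ _ _ hp).1.2)
        fun p hp => h.trans (image_addRight_stdSquare _ _ _ hp).1.1).symm
    · rw [ha] at h
      exact disjoint_interior_of_apply_le 1 _ (fun p hp => (image_addRight_stdSquare _ _ _ hp).2.2)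
        fun p hp => h.trans (image_addRight_stdSquare _ _ _ hp).2.1
    · rw [ha] at h
      exact (disjoint_interior_of_apply_le 1 _
        (fun p hp => (image_addRight_stdSquare _ _ _ hp).2.2)
        fun p hp => h.trans (image_addRight_stdSquare _ _ _ hp).2.1).symm

/-- Squares of sides `s` and `t` fit next to each other above the horizontal line at height `z`. -/
def FitsAbove (z s t : ℝ) : Prop :=
  ∃ p q : ℝ, s ≤ 2 * p ∧ t ≤ 2 * q ∧ s + t ≤ p + q ∧ z ^ 2 + p ^ 2 ≤ 1 ∧ (z + s) ^ 2 + p ^ 2 ≤ 1 ∧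
    z ^ 2 + q ^ 2 ≤ 1 ∧ (z + t) ^ 2 + q ^ 2 ≤ 1

lemma FitsAbove.mono {z s t s' t' : ℝ} (h : FitsAbove z s t) (hs : s' ≤ s) (ht : t' ≤ t)
    (hs0 : 0 ≤ s') (ht0 : 0 ≤ t') : FitsAbove z s' t' := by
  obtain ⟨p, q, h1, h2, h3, h4, h5, h6, h7⟩ := h
  refine ⟨p, q, by linarith, by linarith, by linarith, h4, ?_, h6, ?_⟩
  · rcases le_total 0 (z + s') with h0 | h0 <;> nlinarith
  · rcases le_total 0 (z + t') with h0 | h0 <;> nlinarith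

lemma FitsAbove.packs {z y s t : ℝ} {l : List ℝ} (h : FitsAbove z s t) (hs : 0 ≤ s) (ht : 0 ≤ t)
    (hy : y ≤ z) (hl : Packs (cap y) l) : Packs disk (s :: t :: l) := by
  obtain ⟨p, q, h1, h2, h3, h4, h5, h6, h7⟩ := h
  have two : Packs (disk ∩ {a | z ≤ a.2}) ([s] ++ [t]) := by
    refine (packs_singleton (x := -p) (y := z) hs).append_left (-p + s)
      (packs_singleton (x := q - t) (y := z) ht) ?_ ?_ (fun a ha => ha.1.2)
      (fun a ha => le_trans (by linarith) ha.1.1)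
    · refine subset_inter (rect_subset_disk ?_ ?_ ?_ ?_) fun a ha => ha.2.1 <;> nlinarith
    · refine subset_inter (rect_subset_disk ?_ ?_ ?_ ?_) fun a ha => ha.2.1 <;> nlinarith
  exact two.append_above z hl inter_subset_left (cap_subset_disk y) (fun a ha => ha.2)
    fun a ha => le_trans ha.2 hy

lemma fitsAbove_of_sq_le {s t : ℝ} (ht : 0 ≤ t) (hts : t ≤ s) (h : (s + t) ^ 2 + s ^ 2 ≤ 4) :
    FitsAbove (-(s / 2)) s t := by
  have hp : √(1 - s ^ 2 / 4) ^ 2 = 1 - s ^ 2 / 4 := Real.sq_sqrt (by nlinarith)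
  have hp0 : 0 ≤ √(1 - s ^ 2 / 4) := Real.sqrt_nonneg _
  have hst : s + t ≤ 2 * √(1 - s ^ 2 / 4) := by
    refine le_of_sq_le_sq ?_ (by positivity)
    nlinarith
  refine ⟨√(1 - s ^ 2 / 4), √(1 - s ^ 2 / 4), ?_, ?_, ?_, ?_, ?_, ?_, ?_⟩ <;> nlinarith

/-- The width at height `x` of the unit disk, truncated for `|x| < p`. -/
def chord (p x : ℝ) : ℝ := 2 * √(1 - max (x ^ 2) (p ^ 2))

/-- The area below height `t` of the unit disk, truncated for heights of modulus below `p`. -/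
def capArea (p t : ℝ) : ℝ := ∫ x in (-1)..t, chord p x

lemma chord_intervalIntegrable (p a b : ℝ) :
    IntervalIntegrable (chord p) MeasureTheory.volume a b :=
  Continuous.intervalIntegrable (by unfold chord; fun_prop) a b

@[simp] lemma capArea_neg_one (p : ℝ) : capArea p (-1) = 0 := by simp [capArea]

lemma capArea_sub (p a b : ℝ) : capArea p b - capArea p a = ∫ x in a..b, chord p x := by
  unfold capArea
  rw [sub_eq_iff_eq_add', intervalIntegral.integral_add_adjacent_intervals] <;>
    exact chord_intervalIntegrable ..

lemma capArea_sub_le {p a b w : ℝ} (hab : a ≤ b) (h : ∀ x ∈ Icc a b, chord p x ≤ w) :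
    capArea p b - capArea p a ≤ (b - a) * w := by
  rw [capArea_sub]
  have := intervalIntegral.integral_mono_on (μ := MeasureTheory.volume) hab
    (chord_intervalIntegrable p a b) intervalIntegrable_const h
  simpa using this

lemma le_capArea_sub {p a b w : ℝ} (hab : a ≤ b) (h : ∀ x ∈ Icc a b, w ≤ chord p x) :
    (b - a) * w ≤ capArea p b - capArea p a := by
  rw [capArea_sub]
  have := intervalIntegral.integral_mono_on (μ := MeasureTheory.volume) hab
    intervalIntegrable_const (chord_intervalIntegrable p a b) h
  simpa using this

lemma chord_le_of_sq_le {p x m : ℝ} (h : m ≤ x ^ 2 ∨ m ≤ p ^ 2) : chord p x ≤ 2 * √(1 - m) := by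
  unfold chord
  gcongr
  exact le_max_iff.2 h

lemma le_chord_of_sq_le {p x m : ℝ} (h : x ^ 2 ≤ m) (h' : p ^ 2 ≤ m) :
    2 * √(1 - m) ≤ chord p x := by
  unfold chord
  gcongr
  exact max_le h h'

lemma chord_le_of_cap {p x y q : ℝ} (hy : y ≤ p) (hp : 0 ≤ p) (hq : q < y) (hx : x ≤ q) :
    chord p x ≤ 2 * √(1 - max (y ^ 2) (q ^ 2)) := by
  refine chord_le_of_sq_le ?_
  rcases le_total 0 y with h0 | h0
  · rcases le_total (y ^ 2) (q ^ 2) with h | h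
    · rw [max_eq_right h]; left
      have : q ≤ 0 := by
        by_contra! hq0
        nlinarith
      nlinarith
    · rw [max_eq_left h]; right; nlinarith
  · left; exact max_le (by nlinarith) (by nlinarith)

lemma capArea_le_sqSum_of_not_packs {p : ℝ} (hp : 0 ≤ p) (n : ℕ) : ∀ (h y : ℝ) (l : List ℝ),
    l.length < n → Desc (h :: l) → y ≤ p → y ≤ 1 → -1 ≤ y - h → ¬ Packs (cap y) (h :: l) →
    h ^ 2 + capArea p (y - h) - h * (1 + (y - h)) ≤ sqSum (h :: l) := by
  induction n with
  | zero => simp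
  | succ n ih =>
    intro h y l hn hl hyp hy1 hq hf
    have hh : 0 < h := hl.2 h (by simp)
    set q := y - h with hqdef
    set w := 2 * √(1 - max (y ^ 2) (q ^ 2)) with hw
    have hmax : max (y ^ 2) (q ^ 2) ≤ 1 := max_le (by nlinarith) (by nlinarith)
    have hw2 : (w / 2) ^ 2 = 1 - max (y ^ 2) (q ^ 2) := by
      rw [hw, mul_div_cancel_left₀ _ two_ne_zero, Real.sq_sqrt (by linarith)]
    have hw0 : 0 ≤ w := by positivity
    have hchord : ∀ x ≤ q, chord p x ≤ w := fun x hx =>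
      chord_le_of_cap hyp hp (by linarith) hx
    have hFq : capArea p q ≤ (1 + q) * w := by
      have := capArea_sub_le hq fun x hx => hchord x hx.2
      rw [capArea_neg_one] at this
      linarith
    have hl0 := sqSum_nonneg l
    rcases lt_or_ge w h with hwh | hwh
    · rw [sqSum_cons]
      nlinarith
    obtain ⟨h', t, ht, h'0, h'h, hd, hf', hs⟩ := cap_step hl hwh
      (by rw [hw2]; linarith [le_max_left (y ^ 2) (q ^ 2)])
      (by rw [hw2]; linarith [le_max_right (y ^ 2) (q ^ 2)]) hf
    rcases le_or_gt (-1) (q - h') with hq' | hq'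
    · have := ih h' q t (by omega) hd (by linarith) (by linarith) hq' hf'
      have hd' := capArea_sub_le (by linarith : q - h' ≤ q) fun x hx => hchord x hx.2
      nlinarith [mul_nonneg (sub_nonneg.2 h'h) (by linarith : 0 ≤ 1 + q - h')]
    · have := sqSum_nonneg t
      rw [sqSum_cons h' t] at hs
      nlinarith [mul_nonneg (sub_nonneg.2 hwh) (by linarith : 0 ≤ h' - (1 + q))]

lemma capArea_mul_sq_ge {p : ℝ} {N : ℕ} (hN : 0 < N) : ∀ n : ℕ, n ≤ N → p ≤ 1 - n / N → 0 ≤ p →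
    (f : ℕ → ℕ) → (∀ i < n, f i ^ 2 + (N - i) ^ 2 ≤ N ^ 2) →
    2 * ((∑ i ∈ Finset.range n, f i : ℕ) : ℝ) / N ^ 2 ≤ capArea p (-1 + n / N)
  | 0, _, _, _, _, _ => by simp
  | n + 1, hn, hp, hp0, f, hf => by
    have hN' : (0 : ℝ) < N := by exact_mod_cast hN
    have hnN : ((n : ℝ) + 1) / N ≤ 1 := by
      rw [div_le_one hN']; exact_mod_cast hn
    push_cast at hp ⊢
    have hlt : (n : ℝ) / N ≤ (n + 1) / N := by gcongr; linarith
    have ih := capArea_mul_sq_ge hN n (by omega) (by linarith) hp0 f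
      fun i hi => hf i (by omega)
    have key : (f n : ℝ) / N ≤ √(1 - (1 - n / N) ^ 2) := by
      refine Real.le_sqrt_of_sq_le ?_
      have h1 : ((f n : ℕ) : ℝ) ^ 2 + (N - n) ^ 2 ≤ N ^ 2 := by
        have h2 := hf n (by omega)
        have : n ≤ N := by omega
        zify [this] at h2
        exact_mod_cast h2
      rw [show (1 : ℝ) - (1 - n / N) ^ 2 = (N ^ 2 - (N - n) ^ 2) / N ^ 2 by field_simp, div_pow]
      gcongr
      linarith
    have step := le_capArea_sub (p := p) (a := -1 + n / N) (b := -1 + (n + 1) / N)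
      (w := 2 * ((f n : ℝ) / N)) (by linarith) fun x hx => by
        refine le_trans (by gcongr) (le_chord_of_sq_le (m := (1 - n / N) ^ 2) ?_ ?_)
        · nlinarith [hx.1, hx.2]
        · nlinarith
    rw [show (-1 + ((n : ℝ) + 1) / N - (-1 + n / N)) * (2 * (f n / N)) = 2 * f n / N ^ 2 by
      field_simp; ring] at step
    rw [Finset.sum_range_succ]
    push_cast at ih ⊢
    rw [mul_add, add_div]
    linarith

lemma capArea_ge_linear {p c a K t : ℝ} (hp : 0 ≤ p) (hc : p ≤ c)
    (htp : t ≤ p) (ha : a = 2 * √(1 - c ^ 2)) (hK : K ≤ capArea p (-c) + c * a) :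
    K + a * t ≤ capArea p t := by
  rcases le_total t (-c) with h | h
  · have := capArea_sub_le (p := p) (w := a) h fun x hx => by
      rw [ha]; exact chord_le_of_sq_le (.inl (by nlinarith [hx.2]))
    linarith
  · have := le_capArea_sub (p := p) (w := a) h fun x hx => by
      rw [ha]
      exact le_chord_of_sq_le (by nlinarith [hx.1, hx.2]) (by nlinarith)
    linarith

/-- A linear minorant of the cap area of the disk truncated below modulus `p`. -/
def Minorant (p a K : ℝ) : Prop := ∀ t, -1 ≤ t → t ≤ p → K + a * t ≤ capArea p t

lemma Minorant.le_sqSum {p a K h y : ℝ} {l : List ℝ} (hm : Minorant p a K) (hp : 0 ≤ p)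
    (hl : Desc (h :: l)) (hy : y ≤ p) (hy1 : y ≤ 1) (hq : -1 ≤ y - h)
    (hf : ¬ Packs (cap y) (h :: l)) :
    2 * h ^ 2 + K + a * y - h * (a + 1 + y) ≤ sqSum (h :: l) := by
  have h1 := capArea_le_sqSum_of_not_packs hp _ h y l (Nat.lt_succ_self _) hl hy hy1 hq hf
  have h2 := hm (y - h) hq (by linarith [hl.2 h (by simp)])
  linarith

lemma Minorant.le_sqSum' {p a K h y w : ℝ} {l : List ℝ} (hm : Minorant p a K) (hp : 0 ≤ p)
    (hl : Desc (h :: l)) (hy : y ≤ p) (hy1 : y ≤ 1) (hw : h ≤ w)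
    (h1 : (w / 2) ^ 2 + y ^ 2 ≤ 1) (h2 : (w / 2) ^ 2 + (y - h) ^ 2 ≤ 1)
    (hf : ¬ Packs (cap y) (h :: l)) :
    h ^ 2 - a * h + K + a * y - (a + 1 + y - w) ^ 2 / 4 ≤ sqSum (h :: l) := by
  have hh : 0 < h := hl.2 h (by simp)
  obtain ⟨h', t, -, h'0, h'h, hd, hf', hs⟩ := cap_step hl hw h1 h2 hf
  rcases le_or_gt (-1) (y - h - h') with hq' | hq'
  · have := hm.le_sqSum hp hd (by linarith) (by linarith) hq' hf'
    nlinarith [sq_nonneg (h' - (a + 1 + y - w) / 2)]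
  · have hK := hm (-1) le_rfl (by linarith)
    rw [capArea_neg_one] at hK
    have := sqSum_nonneg t
    rw [sqSum_cons h' t] at hs
    nlinarith [sq_nonneg (1 + y - h - (a + 1 + y - w) / 2),
      mul_nonneg (sub_nonneg.2 hw) (by linarith : 0 ≤ h' - (1 + (y - h)))]

/-- Binary digit extraction of the square root of `n`, starting from the approximation `r`. -/
def sqrtDigits (n : ℕ) : ℕ → ℕ → ℕ
  | 0, r => r
  | k + 1, r => bif (r + 2 ^ k) ^ 2 ≤ n then sqrtDigits n k (r + 2 ^ k) else sqrtDigits n k r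

/-- The integer part of the square root of `n < 2 ^ 22`. -/
def gridSqrt (n : ℕ) : ℕ := sqrtDigits n 11 0

/-- Grid heights `c`, slopes and intercepts of linear minorants of the cap area. -/
def minorants : List (ℤ × ℤ × ℤ) :=
  [(520, 1950, 1825164), (561, 1904, 1800350), (663, 1768, 1717006), (884, 1326, 1370928),
    (1020, 850, 915030)]

lemma gridSqrt_sum_aux (i : ℕ) (hi : i < 585) :
    gridSqrt (1105 ^ 2 - (1105 - i) ^ 2) ^ 2 + (1105 - i) ^ 2 ≤ 1105 ^ 2 := by
  revert i
  decide +kernel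

lemma minorant_grid {c n S : ℕ} {p : ℝ} {A K : ℤ} (hp : 0 ≤ p) (hc : p ≤ c / 1105)
    (hcn : c + n = 1105) (hn : n ≤ 585)
    (hS : ∑ i ∈ Finset.range n, gridSqrt (1105 ^ 2 - (1105 - i) ^ 2) = S) (hA0 : 0 ≤ A)
    (hA : A ^ 2 + 4 * c ^ 2 = 4 * 1105 ^ 2) (hK : K ≤ 2 * S + c * A) :
    Minorant p (A / 1105) (K / 1105 ^ 2) := by
  have hcn' : (c : ℝ) + n = 1105 := by exact_mod_cast hcn
  have h1 : (-1 : ℝ) + n / (1105 : ℕ) = -(c / 1105) := by push_cast; linarith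
  have key := capArea_mul_sq_ge (p := p) (N := 1105) (by norm_num) n (by omega)
    (by push_cast; linarith) hp _ fun i hi => gridSqrt_sum_aux i (by omega)
  rw [h1, hS] at key
  have hA' : (A : ℝ) ^ 2 + 4 * c ^ 2 = 4 * 1105 ^ 2 := by exact_mod_cast hA
  have hA0' : (0 : ℝ) ≤ A := by exact_mod_cast hA0
  have hK' : (K : ℝ) ≤ 2 * S + c * A := by exact_mod_cast hK
  refine fun t ht htp => capArea_ge_linear (c := c / 1105) hp hc htp ?_ ?_
  · have : √(1 - ((c : ℝ) / 1105) ^ 2) = A / 1105 / 2 := by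
      rw [show 1 - ((c : ℝ) / 1105) ^ 2 = (A / 1105 / 2) ^ 2 by linarith,
        Real.sqrt_sq (by positivity)]
    linarith
  · push_cast at key
    linarith

lemma minorant_of_mem {q : ℤ × ℤ × ℤ} (hq : q ∈ minorants) {p : ℝ} (hp : 0 ≤ p)
    (hc : p ≤ q.1 / 1105) : Minorant p (q.2.1 / 1105) (q.2.2 / 1105 ^ 2) := by
  simp only [minorants, List.mem_cons, List.not_mem_nil, or_false] at hq
  rcases hq with rfl | rfl | rfl | rfl | rfl
  · exact minorant_grid (c := 520) (n := 585) (S := 405582) hp (by simpa using hc) rfl (by norm_num)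
      (by decide +kernel) (by norm_num) (by norm_num) (by norm_num)
  · exact minorant_grid (c := 561) (n := 544) (S := 366103) hp (by simpa using hc) rfl (by norm_num)
      (by decide +kernel) (by norm_num) (by norm_num) (by norm_num)
  · exact minorant_grid (c := 663) (n := 442) (S := 272411) hp (by simpa using hc) rfl (by norm_num)
      (by decide +kernel) (by norm_num) (by norm_num) (by norm_num)
  · exact minorant_grid (c := 884) (n := 221) (S := 99372) hp (by simpa using hc) rfl (by norm_num)
      (by decide +kernel) (by norm_num) (by norm_num) (by norm_num)
  · exact minorant_grid (c := 1020) (n := 85) (S := 24015) hp (by simpa using hc) rfl (by norm_num)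
      (by decide +kernel) (by norm_num) (by norm_num) (by norm_num)

/-- Scaled bound of `Minorant.le_sqSum'` for first sides in `[a, b]` and shelf width `w`. -/
def shelfBound (Y a b w : ℤ) (q : ℤ × ℤ × ℤ) : ℤ :=
  min (a ^ 2 - q.2.1 * a) (b ^ 2 - q.2.1 * b - (b - a) ^ 2) + q.2.2 + q.2.1 * Y -
    ((q.2.1 + 1105 + Y - w) ^ 2 + 3) / 4

/-- Scaled bound of `Minorant.le_sqSum` for first sides in `[a, b]`. -/
def capBound (Y a b : ℤ) (q : ℤ × ℤ × ℤ) : ℤ :=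
  min (2 * a ^ 2 - (q.2.1 + 1105 + Y) * a)
    (2 * b ^ 2 - (q.2.1 + 1105 + Y) * b - 2 * (b - a) ^ 2) + q.2.2 + q.2.1 * Y

/-- A lower bound for the scaled area of squares not packing below height `Y`, if the first side
is in `[a, b]`. -/
def cellBound (Y a b : ℤ) : ℤ :=
  let r : ℤ := gridSqrt (1105 ^ 2 - max (Y ^ 2) ((Y - b) ^ 2)).toNat
  if r ^ 2 + Y ^ 2 ≤ 1105 ^ 2 ∧ r ^ 2 + (Y - b) ^ 2 ≤ 1105 ^ 2 ∧ b ≤ 2 * r ∧ -1105 ≤ Y - b then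
    minorants.foldr (fun q m => if Y ≤ q.1 then
      max m (max (shelfBound Y a b (2 * r) q) (capBound Y a b q)) else m) (a ^ 2)
  else a ^ 2

lemma min_tangent_le {a b x k β : ℝ} (hk : 0 ≤ k) (ha : a ≤ x) (hb : x ≤ b) :
    min (k * a ^ 2 - β * a) (k * b ^ 2 - β * b - k * (b - a) ^ 2) ≤ k * x ^ 2 - β * x := by
  have h1 : k * a ^ 2 - β * a + (2 * k * a - β) * (x - a) ≤ k * x ^ 2 - β * x := by
    nlinarith [mul_nonneg hk (sq_nonneg (x - a))]
  rcases le_total 0 (2 * k * a - β) with h | h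
  · refine (min_le_left _ _).trans ?_
    nlinarith [mul_nonneg h (sub_nonneg.2 ha)]
  · refine (min_le_right _ _).trans ?_
    nlinarith [mul_nonneg (neg_nonneg.2 h) (sub_nonneg.2 hb)]

lemma shelfBound_le {p h : ℝ} {l : List ℝ} {Y a b r : ℤ} {q : ℤ × ℤ × ℤ}
    (hm : Minorant p (q.2.1 / 1105) (q.2.2 / 1105 ^ 2)) (hp : 0 ≤ p) (hl : Desc (h :: l))
    (hy : (Y / 1105 : ℝ) ≤ p) (hy1 : (Y / 1105 : ℝ) ≤ 1) (h1 : r ^ 2 + Y ^ 2 ≤ 1105 ^ 2)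
    (h2 : r ^ 2 + (Y - b) ^ 2 ≤ 1105 ^ 2) (hb : b ≤ 2 * r) (ha : (a : ℝ) ≤ h * 1105)
    (hhb : h * 1105 ≤ b) (hf : ¬ Packs (cap (Y / 1105)) (h :: l)) :
    (shelfBound Y a b (2 * r) q : ℝ) ≤ sqSum (h :: l) * 1105 ^ 2 := by
  have hh : 0 < h := hl.2 h (by simp)
  have h1' : (r : ℝ) ^ 2 + Y ^ 2 ≤ 1105 ^ 2 := by exact_mod_cast h1
  have h2' : (r : ℝ) ^ 2 + (Y - b) ^ 2 ≤ 1105 ^ 2 := by exact_mod_cast h2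
  have hb' : (b : ℝ) ≤ 2 * r := by exact_mod_cast hb
  have key := hm.le_sqSum' (w := 2 * r / 1105) hp hl hy hy1 (by linarith)
    (by linarith) (by
      have : (Y - h * 1105 : ℝ) ^ 2 ≤ Y ^ 2 ∨ (Y - h * 1105 : ℝ) ^ 2 ≤ (Y - b) ^ 2 := by
        rcases le_total 0 (Y - h * 1105 : ℝ) with h0 | h0
        · left; nlinarith
        · right; nlinarith
      rcases this with this | this <;> nlinarith) hf
  have hmin := min_tangent_le (k := 1) (β := q.2.1) zero_le_one ha hhb
  have hdiv : ((q.2.1 + 1105 + Y - 2 * r : ℝ) ^ 2) / 4 ≤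
      (((q.2.1 + 1105 + Y - 2 * r) ^ 2 + 3) / 4 : ℤ) := by
    rw [div_le_iff₀ (by norm_num)]
    have : (q.2.1 + 1105 + Y - 2 * r) ^ 2 ≤ ((q.2.1 + 1105 + Y - 2 * r) ^ 2 + 3) / 4 * 4 := by
      omega
    exact_mod_cast this
  unfold shelfBound
  push_cast at hmin ⊢
  simp only [one_mul] at hmin
  nlinarith

lemma capBound_le {p h : ℝ} {l : List ℝ} {Y a b : ℤ} {q : ℤ × ℤ × ℤ}
    (hm : Minorant p (q.2.1 / 1105) (q.2.2 / 1105 ^ 2)) (hp : 0 ≤ p) (hl : Desc (h :: l))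
    (hy : (Y / 1105 : ℝ) ≤ p) (hy1 : (Y / 1105 : ℝ) ≤ 1) (hb : -1105 ≤ Y - b)
    (ha : (a : ℝ) ≤ h * 1105) (hhb : h * 1105 ≤ b) (hf : ¬ Packs (cap (Y / 1105)) (h :: l)) :
    (capBound Y a b q : ℝ) ≤ sqSum (h :: l) * 1105 ^ 2 := by
  have hb' : (-1105 : ℝ) ≤ Y - b := by exact_mod_cast hb
  have key := hm.le_sqSum hp hl hy hy1 (by linarith) hf
  have hmin := min_tangent_le (k := 2) (β := q.2.1 + 1105 + Y) zero_le_two ha hhb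
  unfold capBound
  push_cast at hmin ⊢
  nlinarith

lemma cellBound_le {h : ℝ} {l : List ℝ} {Y a b : ℤ} (hl : Desc (h :: l)) (ha0 : 0 ≤ a)
    (ha : (a : ℝ) ≤ h * 1105) (hhb : h * 1105 ≤ b) (hf : ¬ Packs (cap (Y / 1105)) (h :: l)) :
    (cellBound Y a b : ℝ) ≤ sqSum (h :: l) * 1105 ^ 2 := by
  have ha0' : (0 : ℝ) ≤ a := by exact_mod_cast ha0
  have triv : ((a ^ 2 : ℤ) : ℝ) ≤ sqSum (h :: l) * 1105 ^ 2 := by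
    have := sqSum_nonneg l
    rw [sqSum_cons]
    push_cast
    nlinarith
  unfold cellBound
  simp only
  split_ifs with hc
  · obtain ⟨h1, h2, h3, h4⟩ := hc
    have aux : ∀ L : List (ℤ × ℤ × ℤ), L ⊆ minorants →
        ((L.foldr (fun q m => if Y ≤ q.1 then max m (max (shelfBound Y a b (2 *
          (gridSqrt (1105 ^ 2 - max (Y ^ 2) ((Y - b) ^ 2)).toNat : ℤ)) q) (capBound Y a b q))
          else m) (a ^ 2) : ℤ) : ℝ) ≤ sqSum (h :: l) * 1105 ^ 2 := by
      intro L
      induction L with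
      | nil => simpa using triv
      | cons q L ih =>
        intro hL
        have ih := ih fun x hx => hL (by simp [hx])
        rw [List.foldr_cons]
        split_ifs with hq
        · have hmem := hL (List.mem_cons_self)
          have hq1 : 0 ≤ q.1 ∧ q.1 ≤ 1105 := by
            have : ∀ q ∈ minorants, 0 ≤ q.1 ∧ q.1 ≤ 1105 := by decide
            exact this q hmem
          have hq1' : (0 : ℝ) ≤ q.1 ∧ (q.1 : ℝ) ≤ 1105 := by exact_mod_cast hq1
          have hYq : (Y : ℝ) ≤ q.1 := by exact_mod_cast hq
          have hp : (0 : ℝ) ≤ q.1 / 1105 := by linarith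
          have hm := minorant_of_mem hmem hp le_rfl
          push_cast
          refine max_le ih (max_le ?_ ?_)
          · exact_mod_cast shelfBound_le hm hp hl (by linarith) (by linarith) h1 h2 h3 ha hhb hf
          · exact_mod_cast capBound_le hm hp hl (by linarith) (by linarith) h4 ha hhb hf
        · exact ih
    exact aux _ (List.Subset.refl _)
  · exact triv

/-- Test that two squares, the second with side in `[a, b]`, of area at most `8 / 5` minus `m`
fit next to each other above height `Z`, or that the first is too small for that to matter. -/
def cellFits (Z a b m : ℤ) : Bool :=
  let n := 1953640 - a ^ 2 - m
  let L : ℤ := gridSqrt n.toNat + 1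
  let p : ℤ := gridSqrt (1105 ^ 2 - max (Z ^ 2) ((Z + L) ^ 2)).toNat
  let q : ℤ := gridSqrt (1105 ^ 2 - max (Z ^ 2) ((Z + b) ^ 2)).toNat
  n < a ^ 2 ∨ n ≤ L ^ 2 ∧ (L ≤ -2 * Z ∨ L ≤ 2 * p ∧ b ≤ 2 * q ∧ L + b ≤ p + q ∧
    Z ^ 2 + p ^ 2 ≤ 1105 ^ 2 ∧ (Z + L) ^ 2 + p ^ 2 ≤ 1105 ^ 2 ∧ Z ^ 2 + q ^ 2 ≤ 1105 ^ 2 ∧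
    (Z + b) ^ 2 + q ^ 2 ≤ 1105 ^ 2)

/-- Test all cells between consecutive members of a list, when the remaining squares do not pack
below height `Y`. -/
def cellsFit (Y Z : ℤ) : ℤ → ℤ → List ℤ → Bool
  | a, _, [] => 989 ≤ a
  | a, m, b :: bs => a ≤ b && cellFits Z a b (min m (cellBound Y a b)) &&
      cellsFit Y Z b (min m (cellBound Y a b)) bs

/-- Test the strips between consecutive heights. -/
def rowsFit : ℤ → List (ℤ × List ℤ) → Bool
  | Y, [] => 663 ≤ Y
  | Y, (Z, bs) :: rows => cellsFit Y Z 0 1953640 bs && rowsFit Z rows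

/-- For consecutive grid heights, the end points of a subdivision of the range of sides. -/
def gridRows : List (ℤ × List ℤ) :=
  [(-667, [318, 386, 418, 1000]), (-635, [298, 424, 484, 522, 1000]), (-603, [299, 440, 512, 560,
    596, 625, 1000]), (-571, [323, 448, 519, 567, 604, 635, 662, 686, 709, 732, 1000]), (-539,
    [348, 453, 515, 559, 594, 624, 651, 675, 699, 723, 747, 772, 800, 831, 1000]), (-507, [358,
    460, 523, 571, 610, 645, 679, 712, 746, 783, 826, 877, 942, 1000]), (-475, [359, 465, 536,
    591, 640, 687, 734, 786, 846, 922, 1000]), (-443, [358, 468, 543, 607, 664, 724, 790, 868,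
    943, 1000]), (-411, [357, 487, 580, 663, 748, 840, 921, 995]), (-379, [350, 509, 628, 744,
    844, 932, 1000]), (-347, [343, 522, 641, 746, 833, 911, 1000]), (-315, [335, 518, 633, 723,
    800, 868, 931, 1000]), (-283, [326, 509, 626, 715, 792, 860, 923, 1000]), (-251, [318, 498,
    614, 687, 751, 809, 861, 911, 1000]), (-219, [308, 493, 603, 680, 742, 798, 850, 898, 1000]),
    (-187, [303, 483, 584, 661, 719, 773, 823, 870, 1000]), (-155, [305, 479, 572, 642, 702, 751,
    796, 838, 1000]), (-123, [305, 470, 566, 625, 678, 726, 769, 804, 837, 1000]), (-91, [306,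
    462, 560, 616, 661, 702, 741, 777, 811, 1000]), (-59, [307, 454, 553, 611, 648, 682, 714, 744,
    773, 801, 852, 1000]), (-27, [307, 443, 543, 604, 643, 669, 692, 714, 737, 758, 779, 800, 940,
    1000]), (5, [308, 439, 537, 597, 637, 664, 683, 696, 709, 722, 735, 748, 761, 773, 833,
    1000]), (37, [309, 442, 534, 592, 632, 660, 680, 694, 704, 711, 718, 725, 731, 738, 744, 750,
    756, 763, 836, 1000]), (67, [312, 450, 537, 593, 632, 660, 680, 695, 706, 714, 721, 726, 730,
    733, 735, 737, 739, 741, 744, 746, 768, 918, 1000]), (99, [312, 451, 530, 582, 620, 647, 668,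
    683, 695, 704, 710, 716, 720, 723, 725, 727, 729, 730, 735, 762, 941, 1000]), (131, [313, 456,
    527, 576, 611, 638, 658, 673, 684, 694, 702, 708, 713, 730, 814, 1000]), (163, [314, 460, 531,
    574, 605, 629, 648, 663, 674, 683, 691, 696, 723, 855, 1000]), (195, [315, 466, 535, 573, 601,
    622, 638, 651, 661, 670, 677, 701, 837, 1000]), (227, [313, 466, 537, 574, 597, 614, 628, 639,
    648, 655, 660, 693, 877, 1000]), (259, [310, 465, 538, 576, 597, 610, 620, 628, 634, 639, 649,
    729, 1000]), (291, [307, 459, 536, 577, 600, 613, 620, 626, 671, 933, 1000]), (323, [303, 449,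
    525, 571, 598, 622, 754, 1000]), (355, [300, 440, 512, 554, 580, 620, 833, 1000]), (387, [295,
    429, 497, 536, 559, 585, 704, 1000]), (419, [300, 422, 483, 517, 537, 550, 592, 840, 1000]),
    (451, [305, 422, 471, 498, 513, 521, 531, 561, 664, 1000]), (482, [311, 428, 472, 489, 496,
    499, 501, 502, 503, 506, 514, 536, 603, 1000]), (514, [316, 432, 475, 495, 521, 578, 983,
    1000]), (546, [322, 437, 479, 528, 616, 1000]), (578, [319, 430, 482, 544, 680, 1000]), (610,
    [291, 389, 421, 444, 468, 497, 538, 663, 1000]), (642, [297, 393, 440, 488, 549, 737, 1000]),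
    (674, [303, 397, 466, 544, 672, 1000])]

lemma rowsFit_gridRows : rowsFit (-699) gridRows = true := by
  decide +kernel

lemma fitsAbove_of_cellFits {s t S : ℝ} {Z a b m : ℤ} (hts : t ≤ s) (ht : 0 ≤ t) (ha0 : 0 ≤ a)
    (ha : (a : ℝ) ≤ t * 1105) (hb : t * 1105 ≤ b) (hm : (m : ℝ) ≤ S * 1105 ^ 2)
    (hS : s ^ 2 + t ^ 2 + S ≤ 8 / 5) (hc : cellFits Z a b m = true) :
    (Z / 1105 : ℝ) ≤ -(s / 2) ∨ FitsAbove (Z / 1105) s t := by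
  have ha0' : (0 : ℝ) ≤ a := by exact_mod_cast ha0
  have hn : (s * 1105) ^ 2 ≤ ((1953640 - a ^ 2 - m : ℤ) : ℝ) := by
    push_cast
    nlinarith
  unfold cellFits at hc
  simp only [decide_eq_true_eq] at hc
  have hL0 : (0 : ℤ) ≤ gridSqrt (1953640 - a ^ 2 - m).toNat + 1 := by positivity
  generalize (gridSqrt (1953640 - a ^ 2 - m).toNat + 1 : ℤ) = L at hc hL0
  generalize (gridSqrt (1105 ^ 2 - max (Z ^ 2) ((Z + L) ^ 2)).toNat : ℤ) = p at hc
  generalize (gridSqrt (1105 ^ 2 - max (Z ^ 2) ((Z + b) ^ 2)).toNat : ℤ) = q at hc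
  rcases hc with hc | ⟨hL, hc⟩
  · have : ((1953640 - a ^ 2 - m : ℤ) : ℝ) < a ^ 2 := by exact_mod_cast hc
    nlinarith
  have hL' : ((1953640 - a ^ 2 - m : ℤ) : ℝ) ≤ L ^ 2 := by exact_mod_cast hL
  have hL0' : (0 : ℝ) ≤ L := by exact_mod_cast hL0
  have hs : s * 1105 ≤ L := abs_le_of_sq_le_sq' (hn.trans hL') hL0' |>.2
  rcases hc with hc | ⟨h1, h2, h3, h4, h5, h6, h7⟩
  · have hc' : (L : ℝ) ≤ -2 * Z := by exact_mod_cast hc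
    left; linarith
  · right
    have h1' : (L : ℝ) ≤ 2 * p := by exact_mod_cast h1
    have h2' : (b : ℝ) ≤ 2 * q := by exact_mod_cast h2
    have h3' : (L + b : ℝ) ≤ p + q := by exact_mod_cast h3
    have h4' : (Z ^ 2 + p ^ 2 : ℝ) ≤ 1105 ^ 2 := by exact_mod_cast h4
    have h5' : ((Z + L) ^ 2 + p ^ 2 : ℝ) ≤ 1105 ^ 2 := by exact_mod_cast h5
    have h6' : (Z ^ 2 + q ^ 2 : ℝ) ≤ 1105 ^ 2 := by exact_mod_cast h6
    have h7' : ((Z + b) ^ 2 + q ^ 2 : ℝ) ≤ 1105 ^ 2 := by exact_mod_cast h7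
    have key : FitsAbove (Z / 1105) (L / 1105) (b / 1105) := by
      refine ⟨p / 1105, q / 1105, ?_, ?_, ?_, ?_, ?_, ?_, ?_⟩ <;> linarith
    exact key.mono (by linarith) (by linarith) (by linarith) ht

lemma fitsAbove_of_cellsFit {s t h : ℝ} {l : List ℝ} {Y Z : ℤ} (hts : t ≤ s) (hht : h ≤ t)
    (hl : Desc (h :: l)) (hS : s ^ 2 + t ^ 2 + sqSum (h :: l) ≤ 8 / 5)
    (hf : ¬ Packs (cap (Y / 1105)) (h :: l)) : ∀ (bs : List ℤ) (a m : ℤ), 0 ≤ a →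
    (a : ℝ) ≤ t * 1105 → (h * 1105 ≤ a → (m : ℝ) ≤ sqSum (h :: l) * 1105 ^ 2) →
    cellsFit Y Z a m bs = true → (Z / 1105 : ℝ) ≤ -(s / 2) ∨ FitsAbove (Z / 1105) s t
  | [], a, m, _, ha, _, hc => by
    have h0 := sqSum_nonneg (h :: l)
    have hc' : (989 : ℝ) ≤ a := by
      simp only [cellsFit, decide_eq_true_eq] at hc
      exact_mod_cast hc
    nlinarith
  | b :: bs, a, m, ha0, ha, hm, hc => by
    simp only [cellsFit, Bool.and_eq_true, decide_eq_true_eq] at hc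
    obtain ⟨⟨hab, hc1⟩, hc2⟩ := hc
    have hab' : (a : ℝ) ≤ b := by exact_mod_cast hab
    have hm' : h * 1105 ≤ b → ((min m (cellBound Y a b) : ℤ) : ℝ) ≤ sqSum (h :: l) * 1105 ^ 2 := by
      intro hhb
      push_cast
      rcases le_total (h * 1105) a with hha | hha
      · exact (min_le_left _ _).trans (hm hha)
      · exact (min_le_right _ _).trans (cellBound_le hl ha0 hha hhb hf)
    rcases le_total (t * 1105) b with htb | htb
    · exact fitsAbove_of_cellFits hts ((hl.2 h (by simp)).le.trans hht) ha0 ha htb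
        (hm' (by linarith)) hS hc1
    · exact fitsAbove_of_cellsFit hts hht hl hS hf bs b _ (ha0.trans hab) htb hm' hc2

lemma packs_or_fitsAbove_of_rowsFit {s t : ℝ} {l : List ℝ} (hd : Desc (s :: t :: l))
    (hS : sqSum (s :: t :: l) ≤ 8 / 5) (h0 : FitsAbove (-(s / 2)) s t) :
    ∀ (rows : List (ℤ × List ℤ)) (Y : ℤ), (∃ z : ℝ, Y / 1105 ≤ z ∧ FitsAbove z s t) →
      rowsFit Y rows = true →
      Packs disk (s :: t :: l) ∨ ∃ z : ℝ, 3 / 5 ≤ z ∧ FitsAbove z s t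
  | [], Y, ⟨z, hz, hzf⟩, hr => by
    have hr' : (663 : ℝ) ≤ Y := by
      simp only [rowsFit, decide_eq_true_eq] at hr
      exact_mod_cast hr
    exact .inr ⟨z, by linarith, hzf⟩
  | (Z, bs) :: rows, Y, ⟨z, hz, hzf⟩, hr => by
    simp only [rowsFit, Bool.and_eq_true] at hr
    by_cases hZ : ∃ z : ℝ, Z / 1105 ≤ z ∧ FitsAbove z s t
    · exact packs_or_fitsAbove_of_rowsFit hd hS h0 rows Z hZ hr.2
    left
    have hs0 := hd.2 s (by simp)
    have ht0 := hd.2 t (by simp)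
    have hts : t ≤ s := List.rel_of_pairwise_cons hd.1 (by simp)
    refine hzf.packs hs0.le ht0.le hz ?_
    by_contra hf
    refine hZ ?_
    cases l with
    | nil => exact absurd (packs_nil _) hf
    | cons h l =>
      have hl : Desc (h :: l) := ⟨hd.1.tail.tail, fun x hx => hd.2 x (by simp_all)⟩
      have hht : h ≤ t := List.rel_of_pairwise_cons hd.1.tail (by simp)
      have hh0 := hl.2 h (by simp)
      rw [sqSum_cons, sqSum_cons, ← add_assoc] at hS
      rcases fitsAbove_of_cellsFit hts hht hl hS hf bs 0 1953640 le_rfl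
        (by push_cast; positivity) (fun hh => by push_cast at hh; linarith) hr.1 with h | h
      · exact ⟨_, h, h0⟩
      · exact ⟨_, le_rfl, h⟩

lemma packs_of_fitsAbove_high {s t z : ℝ} {l : List ℝ} (hd : Desc (s :: t :: l))
    (hS : sqSum (s :: t :: l) ≤ 8 / 5) (hz : 3 / 5 ≤ z) (hzf : FitsAbove z s t) :
    Packs disk (s :: t :: l) := by
  have hs0 := hd.2 s (by simp)
  have ht0 := hd.2 t (by simp)
  have hts : t ≤ s := List.rel_of_pairwise_cons hd.1 (by simp)
  refine hzf.packs (y := 3 / 5) hs0.le ht0.le hz ?_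
  by_contra hf
  cases l with
  | nil => exact absurd (packs_nil _) hf
  | cons h l =>
    have hl : Desc (h :: l) := ⟨hd.1.tail.tail, fun x hx => hd.2 x (by simp_all)⟩
    have hht : h ≤ t := List.rel_of_pairwise_cons hd.1.tail (by simp)
    have hh0 := hl.2 h (by simp)
    rw [sqSum_cons, sqSum_cons] at hS
    have hh4 : h ≤ 2 / 5 := by
      obtain ⟨p, q, -, -, -, -, h5, -⟩ := hzf
      nlinarith
    have hm := minorant_of_mem (q := (663, 1768, 1717006)) (by simp [minorants])
      (p := 3 / 5) (by norm_num) (by norm_num)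
    have key := hm.le_sqSum (by norm_num) hl le_rfl (by norm_num) (by linarith) hf
    norm_num at key
    rw [sqSum_cons] at hS
    nlinarith [sq_nonneg (h - 2 / 5)]

/-- Squares of which the two largest fit next to each other above a height pack. -/
lemma packs_of_two_fit {s t : ℝ} {l : List ℝ} (hd : Desc (s :: t :: l))
    (hS : sqSum (s :: t :: l) ≤ 8 / 5) (h : (s + t) ^ 2 + s ^ 2 ≤ 4) :
    Packs disk (s :: t :: l) := by
  have hs0 := hd.2 s (by simp)
  have ht0 := hd.2 t (by simp)
  have hts : t ≤ s := List.rel_of_pairwise_cons hd.1 (by simp)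
  have hl0 := sqSum_nonneg l
  have h0 := fitsAbove_of_sq_le ht0.le hts h
  have hs1 : s ≤ 1398 / 1105 := by
    rw [sqSum_cons, sqSum_cons] at hS
    nlinarith
  rcases packs_or_fitsAbove_of_rowsFit hd hS h0 gridRows (-699)
    ⟨_, by push_cast; linarith, h0⟩ rowsFit_gridRows with h | ⟨z, hz, hzf⟩
  · exact h
  · exact packs_of_fitsAbove_high hd hS hz hzf

lemma pocket_bounds {s m a : ℝ} (hs : 0 < s) (hm : 0 < m) (hms : m ≤ s)
    (hsm : s ^ 2 + (s + m) ^ 2 = 4) (h : s ^ 2 + m ^ 2 ≤ 8 / 5)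
    (ha : a ^ 2 ≤ 2 * (8 / 5 - s ^ 2 - m ^ 2)) :
    a ^ 2 + s * a ≤ s * m ∧ 2 * a ^ 2 + a * m ≤ s * m := by
  have h1 : 0 ≤ (s - m) * (3 * m - s) := by nlinarith
  have hs1 : s ≤ 6 / 5 := by
    by_contra! hlt
    have : 2 / 5 < m := by nlinarith
    nlinarith
  have hm1 : m ≤ 9 / 10 := by nlinarith
  have hak : a ≤ (a ^ 2 + (19 / 50) ^ 2) / (19 / 25) := by
    rw [le_div_iff₀ (by norm_num)]
    nlinarith [sq_nonneg (a - 19 / 50)]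
  constructor
  · have h2 : a ^ 2 + s * a ≤ a ^ 2 + 6 / 5 * ((a ^ 2 + (19 / 50) ^ 2) / (19 / 25)) := by nlinarith
    nlinarith [sq_nonneg (s - m), sq_nonneg (2 * m - s), sq_nonneg (3 * m - 2 * s)]
  · have h2 : 2 * a ^ 2 + a * m ≤ 2 * a ^ 2 + 9 / 10 * ((a ^ 2 + (19 / 50) ^ 2) / (19 / 25)) := by
      nlinarith
    nlinarith [sq_nonneg (s - m), sq_nonneg (2 * m - s), sq_nonneg (3 * m - 2 * s)]

lemma exists_half_chords {s t : ℝ} (hs : 0 < s) (ht : 0 < t)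
    (hS : s ^ 2 + t ^ 2 ≤ 8 / 5) (h : 4 < (s + t) ^ 2 + s ^ 2) :
    ∃ P Q : ℝ, 0 ≤ P ∧ P ≤ Q ∧ P ^ 2 = 1 - s ^ 2 / 4 ∧ Q ^ 2 = 1 - t ^ 2 / 4 ∧ s + t ≤ P + Q ∧
      2 * P < s + t ∧ s < 2 * P := by
  have hP : √(1 - s ^ 2 / 4) ^ 2 = 1 - s ^ 2 / 4 := Real.sq_sqrt (by nlinarith)
  have hQ : √(1 - t ^ 2 / 4) ^ 2 = 1 - t ^ 2 / 4 := Real.sq_sqrt (by nlinarith)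
  have hP0 := Real.sqrt_nonneg (1 - s ^ 2 / 4)
  have hQ0 := Real.sqrt_nonneg (1 - t ^ 2 / 4)
  have hst0 : 0 < s * t := mul_pos hs ht
  have hst : s * t ≤ 4 / 5 := by nlinarith [sq_nonneg (s - t)]
  have hPQ : s * t ≤ √(1 - s ^ 2 / 4) * √(1 - t ^ 2 / 4) := by
    refine le_of_sq_le_sq ?_ (mul_nonneg hP0 hQ0)
    rw [mul_pow (√_), hP, hQ]
    nlinarith [mul_le_mul hst hst hst0.le (by norm_num)]
  generalize √(1 - s ^ 2 / 4) = P at *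
  generalize √(1 - t ^ 2 / 4) = Q at *
  refine ⟨P, Q, hP0, ?_, hP, hQ, ?_, ?_, ?_⟩
  · exact le_of_sq_le_sq (by nlinarith) hQ0
  · exact le_of_sq_le_sq (by nlinarith) (by positivity)
  · exact lt_of_pow_lt_pow_left₀ 2 (by positivity) (by nlinarith)
  · exact lt_of_pow_lt_pow_left₀ 2 (by positivity) (by nlinarith)

/-- Squares of which the two largest do not fit next to each other pack with the largest ones on
top of each other. -/
lemma packs_of_two_large {s t : ℝ} {l : List ℝ} (hd : Desc (s :: t :: l))
    (hS : sqSum (s :: t :: l) ≤ 8 / 5) (h : 4 < (s + t) ^ 2 + s ^ 2) :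
    Packs disk (s :: t :: l) := by
  have hs0 := hd.2 s (by simp)
  have ht0 := hd.2 t (by simp)
  have hts : t ≤ s := List.rel_of_pairwise_cons hd.1 (by simp)
  have hl0 := sqSum_nonneg l
  rw [sqSum_cons, sqSum_cons] at hS
  obtain ⟨P, Q, hP0, hPQ, hP, hQ, hsum, hm, hm0⟩ :=
    exists_half_chords hs0 ht0 (by linarith) h
  obtain ⟨a, ha0, ha⟩ : ∃ a : ℝ, 0 ≤ a ∧ a ^ 2 = 2 * (8 / 5 - s ^ 2 - t ^ 2) :=
    ⟨_, Real.sqrt_nonneg _, Real.sq_sqrt (by linarith)⟩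
  have hmt : (2 * P - s) ^ 2 ≤ t ^ 2 := by gcongr; linarith
  obtain ⟨hp1, hp2⟩ := pocket_bounds (s := s) (m := 2 * P - s) (a := a) hs0 (by linarith)
    (by linarith) (by linarith) (by linarith) (by linarith)
  have hsq : Packs (rect (-(s / 2)) (P - s) s s) [s] := packs_singleton hs0.le
  have htq : Packs (rect (-(t / 2)) (P - s - t) t t) [t] := packs_singleton ht0.le
  have hpocket : Packs (rect (s / 2) (P - s) a a) l := by
    cases l with
    | nil => exact packs_nil _
    | cons h l =>
      have hl : Desc (h :: l) := ⟨hd.1.tail.tail, fun x hx => hd.2 x (by simp_all)⟩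
      have hh0 := hl.2 h (by simp)
      have h1 := sqSum_nonneg l
      have hha : h ≤ a := by
        rw [sqSum_cons] at hS
        nlinarith
      exact packs_rect _ _ _ _ _ _ _ le_rfl hl hha hha (by nlinarith [sq_nonneg (2 * h - a)])
  have hb1 : (P - s - t) ^ 2 ≤ Q ^ 2 := sq_le_sq' (by linarith) (by linarith)
  have hb2 : (P - s) ^ 2 ≤ Q ^ 2 := sq_le_sq' (by linarith) (by linarith)
  have hb3 : (P - s) ^ 2 ≤ P ^ 2 := sq_le_sq' (by linarith) (by linarith)
  have hsa := mul_nonneg hs0.le ha0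
  have hlow : Packs (disk ∩ {p | p.2 ≤ P - s ∨ s / 2 ≤ p.1}) ([t] ++ l) := by
    refine htq.append hpocket
      (subset_inter (rect_subset_disk (by linarith) (by linarith) (by linarith) (by linarith)) ?_)
      (subset_inter (rect_subset_disk (by linarith) (by nlinarith) (by linarith) (by linarith)) ?_)
      ?_
    · rintro p ⟨-, -, hp⟩
      exact .inl (by linarith)
    · exact fun p hp => .inr hp.1.1
    · intro x y hx hy
      have h1 := hx.corner'.2.2
      have h2 := hy.corner.2.1
      exact .inr (.inr (.inl (by simp only at h1 h2; linarith)))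
  refine hsq.append hlow (rect_subset_disk (by linarith) (by linarith) (by linarith) (by linarith))
    inter_subset_left ?_
  · intro x y hx hy
    have h1 := hx.corner'.1.2
    have h2 := hx.corner.2.1
    rcases (hy.2 y.x ⟨le_rfl, by linarith [hy.1]⟩ (y.y + y.s) ⟨by linarith [hy.1], le_rfl⟩).2
      with h3 | h3
    · exact .inr (.inr (.inr (by simp only at h2 h3; linarith)))
    · exact .inl (by simp only at h1 h3; linarith)

lemma packs_disk_of_sqSum_le : ∀ l : List ℝ, Desc l → sqSum l ≤ 8 / 5 → Packs disk l
  | [], _, _ => packs_nil _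
  | [s], hd, hS => by
    have hs0 := hd.2 s (by simp)
    rw [sqSum_cons, sqSum_nil, add_zero] at hS
    refine (packs_singleton (x := -(s / 2)) (y := -(s / 2)) hs0.le).mono
      (rect_subset_disk ?_ ?_ ?_ ?_) <;> linarith
  | s :: t :: l, hd, hS => by
    rcases le_or_gt ((s + t) ^ 2 + s ^ 2) 4 with h | h
    · exact packs_of_two_fit hd hS h
    · exact packs_of_two_large hd hS h

theorem squares_pack_into_unit_disk (n : ℕ) (hn : 1 ≤ n) (s : Fin n → ℝ)
    (hpos : ∀ i, 0 < s i) (harea : ∑ i, (s i) ^ 2 ≤ 8 / 5) :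
    ∃ f : Fin n → (Plane ≃ᵢ Plane),
      (∀ i, (f i) '' stdSquare (s i) ⊆ unitDisk) ∧
      (∀ i j, i ≠ j →
        Disjoint (interior ((f i) '' stdSquare (s i)))
                 (interior ((f j) '' stdSquare (s j)))) := by
  let σ := Tuple.sort fun i => -s i
  have hσ : Monotone fun i => -s (σ i) := Tuple.monotone_sort fun i => -s i
  refine exists_isometryEquiv_of_packs σ (packs_disk_of_sqSum_le _ ⟨?_, ?_⟩ ?_)
  · rw [List.pairwise_ofFn]
    exact fun i j hij => neg_le_neg_iff.1 (hσ hij.le)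
  · intro x hx
    obtain ⟨i, rfl⟩ := List.mem_ofFn.1 hx
    exact hpos _
  · rw [sqSum, List.map_ofFn, List.sum_ofFn]
    exact (Equiv.sum_comp σ fun i => s i ^ 2).trans_le harea
end
end

section
/- If s > 2/√5 and f is an isometry of ℝ² such that the square Q = f([0,s]×[0,s]) is contained in the closed unit disk D, then the center of D (the origin) lies in the interior of Q. -/
noncomputable section
open Set Metric

/-- If both endpoints of a side of length `s` of a rectangle lie in the unit disk and the line through
that side is at distance `t ≥ s` from the center, then `5 * s ^ 2 ≤ 4`. -/
lemma five_mul_sq_le_four_of_far_side {s t b : ℝ} (hs : 0 < s) (hst : s ≤ t)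
    (h₁ : t ^ 2 + b ^ 2 ≤ 1) (h₂ : t ^ 2 + (s - b) ^ 2 ≤ 1) : 5 * s ^ 2 ≤ 4 := by
  have : s ^ 2 ≤ t ^ 2 := by gcongr
  linarith [sq_nonneg (2 * b - s)]

lemma mem_interior_stdSquare {s : ℝ} {p : Plane} (h0 : p 0 ∈ Ioo 0 s) (h1 : p 1 ∈ Ioo 0 s) :
    p ∈ interior (stdSquare s) := by
  refine mem_interior.2 ⟨{q | q 0 ∈ Ioo 0 s ∧ q 1 ∈ Ioo 0 s},
    fun q hq => ⟨Ioo_subset_Icc_self hq.1, Ioo_subset_Icc_self hq.2⟩, ?_, h0, h1⟩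
  exact (isOpen_Ioo.preimage (by fun_prop : Continuous fun q : Plane => q 0)).inter
    (isOpen_Ioo.preimage (by fun_prop : Continuous fun q : Plane => q 1))

theorem large_square_contains_center (s : ℝ) (hs : 2 / Real.sqrt 5 < s)
    (f : Plane ≃ᵢ Plane) (hsub : f '' stdSquare s ⊆ unitDisk) :
    (0 : Plane) ∈ interior (f '' stdSquare s) := by
  have hs0 : 0 < s := lt_trans (by positivity) hs
  have hs2 : 4 < 5 * s ^ 2 := by
    have h : (2 / Real.sqrt 5) ^ 2 < s ^ 2 := by gcongr
    rw [div_pow, Real.sq_sqrt (by norm_num)] at h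
    linarith
  obtain ⟨c, hc⟩ := f.surjective 0
  have corner (x y : ℝ) (hx : x ∈ Icc 0 s) (hy : y ∈ Icc 0 s) :
      (x - c 0) ^ 2 + (y - c 1) ^ 2 ≤ 1 := by
    have h : dist (f !₂[x, y]) 0 ≤ 1 := hsub ⟨!₂[x, y], ⟨by simpa using hx, by simpa using hy⟩, rfl⟩
    rw [← hc, f.dist_eq, EuclideanSpace.dist_eq, Real.sqrt_le_one] at h
    simpa [Fin.sum_univ_two, Real.dist_eq] using h
  have left_mem : (0 : ℝ) ∈ Icc 0 s := left_mem_Icc.2 hs0.le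
  have right_mem : s ∈ Icc 0 s := right_mem_Icc.2 hs0.le
  have h00 := corner 0 0 left_mem left_mem
  have h0s := corner 0 s left_mem right_mem
  have hs0' := corner s 0 right_mem left_mem
  have hss := corner s s right_mem right_mem
  have key {t b : ℝ} (h₁ : t ^ 2 + b ^ 2 ≤ 1) (h₂ : t ^ 2 + (s - b) ^ 2 ≤ 1) : t < s := by
    by_contra! hst
    linarith [five_mul_sq_le_four_of_far_side hs0 hst h₁ h₂]
  have hc0 : c 0 ∈ Ioo 0 s :=
    ⟨by linarith [key (t := s - c 0) (b := c 1) (by linarith) hss],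
      key (t := c 0) (b := c 1) (by linarith) (by linarith)⟩
  have hc1 : c 1 ∈ Ioo 0 s :=
    ⟨by linarith [key (t := s - c 1) (b := c 0) (by linarith) (by linarith)],
      key (t := c 1) (b := c 0) (by linarith) (by linarith)⟩
  have himage := f.toHomeomorph.image_interior (stdSquare s)
  rw [IsometryEquiv.coe_toHomeomorph] at himage
  rw [← himage]
  exact ⟨c, mem_interior_stdSquare hc0 hc1, hc⟩
end
end

section
/- For every ε > 0 there exists a finite collection of squares of total area exactly 8/5 + ε that cannot be packed into the closed unit disk; in fact, the two squares each of side length √(4/5 + ε/2) have total area 8/5 + ε and cannot be packed into the closed unit disk. -/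
noncomputable section
open Set Metric

/-- A point within distance `1` of every point of a square of side `s`, where `s ^ 2 > 4 / 5`, lies
in the interior of that square. -/
theorem mem_interior_stdSquare_s4 {s : ℝ} (hs : 0 < s) (hs2 : 4 / 5 < s ^ 2) {q : Plane}
    (hq : ∀ p ∈ stdSquare s, dist p q ≤ 1) : q ∈ interior (stdSquare s) := by
  have corner (a b : ℝ) (ha : a ∈ Icc 0 s) (hb : b ∈ Icc 0 s) :
      (a - q 0) ^ 2 + (b - q 1) ^ 2 ≤ 1 := by
    have h := hq !₂[a, b] (by simpa [stdSquare] using ⟨ha, hb⟩)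
    rw [EuclideanSpace.dist_eq, Real.sqrt_le_iff] at h
    simpa [Fin.sum_univ_two, Real.dist_eq, sq_abs] using h.2
  have h0 : (0 : ℝ) ∈ Icc 0 s := ⟨le_rfl, hs.le⟩
  have h1 : s ∈ Icc 0 s := ⟨hs.le, le_rfl⟩
  have c00 := corner 0 0 h0 h0
  have c01 := corner 0 s h0 h1
  have c10 := corner s 0 h1 h0
  have c11 := corner s s h1 h1
  have hopen : IsOpen {p : Plane | (0 < p 0 ∧ p 0 < s) ∧ 0 < p 1 ∧ p 1 < s} := by
    simp only [ofPred_and]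
    refine IsOpen.inter (IsOpen.inter ?_ ?_) (IsOpen.inter ?_ ?_) <;>
      exact isOpen_lt (by fun_prop) (by fun_prop)
  refine interior_maximal (fun p hp => ?_) hopen ⟨⟨?_, ?_⟩, ?_, ?_⟩
  · exact ⟨⟨hp.1.1.le, hp.1.2.le⟩, hp.2.1.le, hp.2.2.le⟩
  all_goals
    by_contra! h
    nlinarith [sq_nonneg (2 * q 0 - s), sq_nonneg (2 * q 1 - s), sq_nonneg (q 0),
      sq_nonneg (q 1), sq_nonneg (q 0 - s), sq_nonneg (q 1 - s)]

/-- A congruent copy of a square of side `s`, where `s ^ 2 > 4 / 5`, inside the unit disk contains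
the center of the disk in its interior. -/
theorem zero_mem_interior_image_stdSquare {s : ℝ} (hs : 0 < s) (hs2 : 4 / 5 < s ^ 2)
    (f : Plane ≃ᵢ Plane) (hf : f '' stdSquare s ⊆ unitDisk) :
    (0 : Plane) ∈ interior (f '' stdSquare s) := by
  have h : interior (f '' stdSquare s) = f '' interior (stdSquare s) :=
    (f.toHomeomorph.image_interior _).symm
  rw [h]
  refine ⟨f.symm 0, mem_interior_stdSquare_s4 hs hs2 fun p hp => ?_, f.apply_symm_apply 0⟩
  rw [← f.dist_eq, f.apply_symm_apply]
  exact hf (mem_image_of_mem f hp)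

theorem critical_density_upper_bound (ε : ℝ) (hε : 0 < ε) :
    (Real.sqrt (4 / 5 + ε / 2)) ^ 2 + (Real.sqrt (4 / 5 + ε / 2)) ^ 2 = 8 / 5 + ε ∧
    ¬ ∃ f g : Plane ≃ᵢ Plane,
      f '' stdSquare (Real.sqrt (4 / 5 + ε / 2)) ⊆ unitDisk ∧
      g '' stdSquare (Real.sqrt (4 / 5 + ε / 2)) ⊆ unitDisk ∧
      Disjoint (interior (f '' stdSquare (Real.sqrt (4 / 5 + ε / 2))))
               (interior (g '' stdSquare (Real.sqrt (4 / 5 + ε / 2)))) := by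
  have hpos : 0 < 4 / 5 + ε / 2 := by positivity
  have hsq := Real.sq_sqrt hpos.le
  refine ⟨by rw [hsq]; ring, ?_⟩
  rintro ⟨f, g, hf, hg, hfg⟩
  have hs := Real.sqrt_pos.2 hpos
  have hs2 : 4 / 5 < Real.sqrt (4 / 5 + ε / 2) ^ 2 := by rw [hsq]; linarith
  exact disjoint_left.1 hfg (zero_mem_interior_image_stdSquare hs hs2 f hf)
    (zero_mem_interior_image_stdSquare hs hs2 g hg)
end
end

section
/- (Moon–Moser shelf packing) Let h ≤ w be positive reals and let t₁, …, t_u > 0 be side lengths of squares with tᵢ ≤ h for all i and total area t₁² + ⋯ + t_u² ≤ (1/2)·h·w. Then the squares can be packed axis-parallel into the rectangle [0,w] × [0,h]: there exist translation vectors v₁, …, v_u ∈ ℝ² such that vᵢ + [0,tᵢ]×[0,tᵢ] ⊆ [0,w]×[0,h] for every i and the interiors of these translated squares are pairwise disjoint. -/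
noncomputable section
open Set Metric

/-- The axis-parallel rectangle [0,w] × [0,h]. -/
def stdRect (w h : ℝ) : Set Plane := {p | p 0 ∈ Icc 0 w ∧ p 1 ∈ Icc 0 h}

/-- The squares with lower left corners `(x i, y i)` and sides `t i`, `i ∈ s`, do not overlap. -/
def NonOverlapping {ι : Type*} (s : Finset ι) (t x y : ι → ℝ) : Prop :=
  ∀ i ∈ s, ∀ j ∈ s, i ≠ j →
    x i + t i ≤ x j ∨ x j + t j ≤ x i ∨ y i + t i ≤ y j ∨ y j + t j ≤ y i

/-- The squares can be packed into `[0, w] × [0, h]` inside the region that remains free while a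
vertical shelf occupying the strip between the abscissas `X` and `e` is filled up to height `b`. -/
def ShelfPackable {ι : Type*} (s : Finset ι) (t : ι → ℝ) (w h X e b : ℝ) : Prop :=
  ∃ x y : ι → ℝ,
    (∀ i ∈ s, x i + t i ≤ w ∧ y i + t i ≤ h ∧ ((X ≤ x i ∧ b ≤ y i) ∨ (e ≤ x i ∧ 0 ≤ y i))) ∧
    NonOverlapping s t x y

/-- Add one square at the bottom of the free part of a shelf. -/
theorem ShelfPackable.insert {ι : Type*} [DecidableEq ι] {s : Finset ι} {t : ι → ℝ}
    {w h X e b : ℝ} {a : ι} (ha : a ∉ s) (hp : ShelfPackable s t w h X e (b + t a))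
    (hta : 0 ≤ t a) (hXe : X + t a ≤ e) (hew : e ≤ w) (hb : b + t a ≤ h) :
    ShelfPackable (insert a s) t w h X e b := by
  obtain ⟨x, y, hin, hsep⟩ := hp
  have hne : ∀ i ∈ s, i ≠ a := fun i hi hia => ha (hia ▸ hi)
  refine ⟨Function.update x a X, Function.update y a b, ?_, ?_⟩
  · intro i hi
    rcases Finset.mem_insert.1 hi with rfl | hi
    · simp only [Function.update_self]
      exact ⟨by linarith, hb, Or.inl ⟨le_rfl, le_rfl⟩⟩
    · simp only [Function.update_of_ne (hne i hi)]
      obtain ⟨h1, h2, h3⟩ := hin i hi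
      exact ⟨h1, h2, h3.imp (fun h => ⟨h.1, by linarith [h.2]⟩) id⟩
  · intro i hi j hj hij
    rcases Finset.mem_insert.1 hi with rfl | hi <;> rcases Finset.mem_insert.1 hj with rfl | hj
    · exact absurd rfl hij
    · simp only [Function.update_self, Function.update_of_ne (hne j hj)]
      rcases (hin j hj).2.2 with h | h
      · exact Or.inr (Or.inr (Or.inl h.2))
      · exact Or.inl (hXe.trans h.1)
    · have hi := Finset.mem_of_mem_insert_of_ne hi hij
      simp only [Function.update_self, Function.update_of_ne (hne i hi)]
      rcases (hin i hi).2.2 with h | h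
      · exact Or.inr (Or.inr (Or.inr h.2))
      · exact Or.inr (Or.inl (hXe.trans h.1))
    · simp only [Function.update_of_ne (hne i hi), Function.update_of_ne (hne j hj)]
      exact hsep i hi j hj hij

/-- A packing using only the shelves to the right of the current one. -/
theorem ShelfPackable.of_next {ι : Type*} {s : Finset ι} {t : ι → ℝ} {w h X e e' b : ℝ}
    (hp : ShelfPackable s t w h e e' 0) (hee' : e ≤ e') : ShelfPackable s t w h X e b := by
  obtain ⟨x, y, hin, hsep⟩ := hp
  refine ⟨x, y, fun i hi => ?_, hsep⟩
  obtain ⟨h1, h2, h3⟩ := hin i hi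
  exact ⟨h1, h2, Or.inr (h3.elim id fun h => ⟨hee'.trans h.1, h.2⟩)⟩

/-- The greedy shelf algorithm, taking squares in decreasing order, succeeds from a given state
if the remaining area is small enough. -/
theorem shelfPackable_of_sum_sq_le {ι : Type*} [DecidableEq ι] (t : ι → ℝ) (htpos : ∀ i, 0 < t i)
    {w h c : ℝ} (hch : c ≤ h) (s : Finset ι) :
    ∀ X e b m : ℝ, (∀ i ∈ s, t i ≤ m) → m ≤ h → X + m ≤ e → e ≤ w → (m ≤ c ∨ h ≤ 2 * c) →
      ∑ i ∈ s, t i ^ 2 ≤ (h - c) * (w - e) - max (b - c) 0 * m →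
      ShelfPackable s t w h X e b := by
  induction s using Finset.induction_on_max_value t with
  | empty => intro X e b m _ _ _ _ _ _; exact ⟨0, 0, by simp, by simp [NonOverlapping]⟩
  | insert a s ha hmax ih =>
    intro X e b m hm hmh hXe hew hc hsum
    rw [Finset.sum_insert ha] at hsum
    have hta := htpos a
    have ham : t a ≤ m := hm a (Finset.mem_insert_self a s)
    have hc' : t a ≤ c ∨ h ≤ 2 * c := hc.imp_left ham.trans
    have hM0 : 0 ≤ max (b - c) 0 := le_max_right _ _
    have hMb : b - c ≤ max (b - c) 0 := le_max_left _ _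
    have hMm : max (b - c) 0 * t a ≤ max (b - c) 0 * m := mul_le_mul_of_nonneg_left ham hM0
    by_cases hb : b + t a ≤ h
    · refine ShelfPackable.insert ha (ih X e (b + t a) (t a) hmax (ham.trans hmh)
        (by linarith) hew hc' ?_) hta.le (by linarith) hew hb
      have hM : max (b + t a - c) 0 ≤ max (b - c) 0 + t a :=
        max_le (by linarith) (by linarith)
      nlinarith
    · push Not at hb
      have hfit : e + t a ≤ w := by
        by_contra! hlt
        have hs : 0 ≤ ∑ i ∈ s, t i ^ 2 := Finset.sum_nonneg fun i _ => sq_nonneg _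
        nlinarith [mul_nonneg (sub_nonneg.2 hch) (sub_nonneg.2 hlt.le),
          mul_le_mul_of_nonneg_right hMb hta.le, mul_lt_mul_of_pos_right hb hta]
      refine ShelfPackable.of_next (e' := e + t a) ?_ (by linarith)
      refine ShelfPackable.insert ha (ih e (e + t a) (0 + t a) (t a) hmax (ham.trans hmh)
        le_rfl hfit hc' ?_) hta.le le_rfl hfit (by linarith)
      have hM : max (0 + t a - c) 0 ≤ max (b - c) 0 + t a + c - h :=
        max_le (by rcases hc' with h' | h' <;> linarith) (by linarith)
      nlinarith

/-- Coordinates of interior points of a translated square. -/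
theorem mem_Ioo_of_mem_interior_square {v p : Plane} {s : ℝ}
    (hp : p ∈ interior ((fun q => v + q) '' stdSquare s)) (k : Fin 2) :
    p k ∈ Ioo (v k) (v k + s) := by
  have hsub : (fun q => v + q) '' stdSquare s ⊆
      (EuclideanSpace.proj k : Plane →L[ℝ] ℝ) ⁻¹' Icc (v k) (v k + s) := by
    rintro _ ⟨q, ⟨⟨h0, h0'⟩, h1, h1'⟩, rfl⟩
    fin_cases k <;> simp [*]
  have hopen : IsOpenMap (EuclideanSpace.proj k : Plane →L[ℝ] ℝ) :=
    ContinuousLinearMap.isOpenMap _ fun r => ⟨EuclideanSpace.single k r, by simp⟩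
  have hmem := interior_mono hsub hp
  rw [← hopen.preimage_interior_eq_interior_preimage (ContinuousLinearMap.continuous _),
    interior_Icc] at hmem
  exact hmem

theorem shelf_packing (h w : ℝ) (hh : 0 < h) (hhw : h ≤ w)
    (u : ℕ) (t : Fin u → ℝ) (htpos : ∀ i, 0 < t i) (hth : ∀ i, t i ≤ h)
    (harea : ∑ i, (t i) ^ 2 ≤ 1 / 2 * (h * w)) :
    ∃ v : Fin u → Plane,
      (∀ i, (fun p => v i + p) '' stdSquare (t i) ⊆ stdRect w h) ∧
      (∀ i j, i ≠ j →
        Disjoint (interior ((fun p => v i + p) '' stdSquare (t i)))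
                 (interior ((fun p => v j + p) '' stdSquare (t j)))) := by
  obtain hu | hu := isEmpty_or_nonempty (Fin u)
  · exact ⟨0, fun i => isEmptyElim i, fun i => isEmptyElim i⟩
  obtain ⟨a, -, hmax⟩ := Finset.exists_max_image Finset.univ t Finset.univ_nonempty
  have hta := htpos a
  have hpack : ShelfPackable Finset.univ t w h 0 (t a) 0 := by
    rw [← Finset.insert_erase (Finset.mem_univ a)]
    have hsum := Finset.add_sum_erase Finset.univ (fun i => t i ^ 2) (Finset.mem_univ a)
    refine ShelfPackable.insert (Finset.notMem_erase a _) ?_ hta.le (by simp)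
      ((hth a).trans hhw) (by simpa using hth a)
    rcases le_total (t a) (h / 2) with hle | hle
    · refine shelfPackable_of_sum_sq_le t htpos (c := t a) (hth a) _ _ _ _ (t a)
        (fun i _ => hmax i (Finset.mem_univ i)) (hth a) (by simp) ((hth a).trans hhw)
        (Or.inl le_rfl) ?_
      simp only [zero_add, sub_self, max_self, zero_mul, sub_zero]
      nlinarith [mul_nonneg (sub_nonneg.2 hle) (sub_nonneg.2 (show t a ≤ w / 2 by linarith))]
    · refine shelfPackable_of_sum_sq_le t htpos (c := h / 2) (by linarith) _ _ _ _ (t a)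
        (fun i _ => hmax i (Finset.mem_univ i)) (hth a) (by simp) ((hth a).trans hhw)
        (Or.inr (by linarith)) ?_
      rw [zero_add, max_eq_left (by linarith)]
      nlinarith
  obtain ⟨x, y, hin, hsep⟩ := hpack
  refine ⟨fun i => !₂[x i, y i], ?_, ?_⟩
  · rintro i _ ⟨q, ⟨⟨h0, h0'⟩, h1, h1'⟩, rfl⟩
    obtain ⟨hx, hy, hxy⟩ := hin i (Finset.mem_univ i)
    have hx0 : 0 ≤ x i := hxy.elim And.left fun h => hta.le.trans h.1
    have hy0 : 0 ≤ y i := hxy.elim And.right And.right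
    simp only [stdRect, Set.mem_ofPred_eq, mem_Icc, PiLp.add_apply,
      Matrix.cons_val_zero, Matrix.cons_val_one]
    exact ⟨⟨by linarith, by linarith⟩, by linarith, by linarith⟩
  · intro i j hij
    refine Set.disjoint_left.2 fun p hpi hpj => ?_
    have hi0 := mem_Ioo_of_mem_interior_square hpi 0
    have hi1 := mem_Ioo_of_mem_interior_square hpi 1
    have hj0 := mem_Ioo_of_mem_interior_square hpj 0
    have hj1 := mem_Ioo_of_mem_interior_square hpj 1
    simp only [mem_Ioo, Matrix.cons_val_zero, Matrix.cons_val_one]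
      at hi0 hi1 hj0 hj1
    rcases hsep i (Finset.mem_univ i) j (Finset.mem_univ j) hij with h | h | h | h <;> linarith
end
end

section
/- Let 0 < x₁ < 1/2 and let t₁, …, t_u > 0 be side lengths of squares with tᵢ ≤ x₁ for all i and total area t₁² + ⋯ + t_u² ≤ 1/2 + 2·(x₁ − 1/2)². Then the squares can be packed axis-parallel into the unit square [0,1] × [0,1]: there exist translation vectors v₁, …, v_u ∈ ℝ² such that vᵢ + [0,tᵢ]×[0,tᵢ] ⊆ [0,1]×[0,1] for every i and the interiors of these translated squares are pairwise disjoint. -/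
noncomputable section
open Set Metric

/-- The squares `vᵢ + [0,tᵢ]²` and `vⱼ + [0,tⱼ]²` are separated by a line parallel to an axis. -/
def AxisSeparated {ι : Type*} (t : ι → ℝ) (v : ι → ℝ × ℝ) (i j : ι) : Prop :=
  (v i).1 + t i ≤ (v j).1 ∨ (v j).1 + t j ≤ (v i).1 ∨
    (v i).2 + t i ≤ (v j).2 ∨ (v j).2 + t j ≤ (v i).2

theorem AxisSeparated.symm {ι : Type*} {t : ι → ℝ} {v : ι → ℝ × ℝ} {i j : ι}
    (h : AxisSeparated t v i j) : AxisSeparated t v j i := by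
  unfold AxisSeparated at *
  tauto

/-- Placing one more square `a` at position `q` in a packing of the remaining ones. -/
theorem exists_packing_of_erase {ι : Type*} [DecidableEq ι] {t : ι → ℝ} {s : Finset ι} {a : ι}
    {Q : ι → ℝ × ℝ → Prop} (q : ℝ × ℝ) (hq : Q a q)
    (h : ∃ v : ι → ℝ × ℝ, (∀ i ∈ s.erase a, Q i (v i) ∧
        (q.1 + t a ≤ (v i).1 ∨ q.2 + t a ≤ (v i).2)) ∧
      ∀ i ∈ s.erase a, ∀ j ∈ s.erase a, i ≠ j → AxisSeparated t v i j) :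
    ∃ v : ι → ℝ × ℝ, (∀ i ∈ s, Q i (v i)) ∧
      ∀ i ∈ s, ∀ j ∈ s, i ≠ j → AxisSeparated t v i j := by
  obtain ⟨v, hv, hsep⟩ := h
  have key : ∀ i ∈ s, i ≠ a → AxisSeparated t (Function.update v a q) a i := by
    intro i hi hia
    have := (hv i (Finset.mem_erase.2 ⟨hia, hi⟩)).2
    simp only [AxisSeparated, Function.update_self, Function.update_of_ne hia]
    tauto
  refine ⟨Function.update v a q, fun i hi => ?_, fun i hi j hj hij => ?_⟩
  · by_cases hia : i = a
    · subst hia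
      simpa using hq
    · rw [Function.update_of_ne hia]
      exact (hv i (Finset.mem_erase.2 ⟨hia, hi⟩)).1
  · by_cases hia : i = a
    · subst hia
      exact key j hj hij.symm
    · by_cases hja : j = a
      · subst hja
        exact (key i hi hia).symm
      · simpa only [AxisSeparated, Function.update_of_ne hia, Function.update_of_ne hja] using
          hsep i (Finset.mem_erase.2 ⟨hia, hi⟩) j (Finset.mem_erase.2 ⟨hja, hj⟩) hij

/-- Greedy shelf packing, started from a shelf `[0,1] × [y,y+h]` that is filled up to abscissa
`x`. -/
theorem exists_shelf_packing {ι : Type*} [DecidableEq ι] (t : ι → ℝ) (c : ℝ) (hc : c < 1)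
    (s : Finset ι) (x y h : ℝ) (hx : h ≤ x) (hx0 : 0 ≤ x) (hy : 0 ≤ y) (hhc : h ≤ c)
    (hyh : y + h ≤ 1) (hpos : ∀ i ∈ s, 0 < t i) (hle : ∀ i ∈ s, t i ≤ h)
    (harea : ∀ i ∈ s, ∑ j ∈ s, t j ^ 2 ≤ (1 - c) * (1 - y - h) - (x - h) * t i) :
    ∃ v : ι → ℝ × ℝ,
      (∀ i ∈ s, 0 ≤ (v i).1 ∧ (v i).1 + t i ≤ 1 ∧ y ≤ (v i).2 ∧ (v i).2 + t i ≤ 1 ∧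
        (x ≤ (v i).1 ∨ y + h ≤ (v i).2)) ∧
      ∀ i ∈ s, ∀ j ∈ s, i ≠ j → AxisSeparated t v i j := by
  induction hn : s.card generalizing s x y h with
  | zero =>
    obtain rfl := Finset.card_eq_zero.1 hn
    exact ⟨0, by simp, by simp⟩
  | succ n ih =>
    have hne : s.Nonempty := Finset.card_pos.1 (by omega)
    obtain ⟨a, ha, hmax⟩ := s.exists_max_image t hne
    have hcard : (s.erase a).card = n := by rw [Finset.card_erase_of_mem ha]; omega
    have hsum := Finset.add_sum_erase s (fun j => t j ^ 2) ha
    have hrest : 0 ≤ ∑ j ∈ s.erase a, t j ^ 2 := Finset.sum_nonneg fun j _ => sq_nonneg _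
    have hpos' : ∀ i ∈ s.erase a, 0 < t i := fun i hi => hpos i (Finset.mem_of_mem_erase hi)
    have hmax' : ∀ i ∈ s.erase a, t i ≤ t a := fun i hi => hmax i (Finset.mem_of_mem_erase hi)
    have ha0 := hpos a ha
    have hah := hle a ha
    have hA := harea a ha
    by_cases hfit : x + t a ≤ 1
    · refine exists_packing_of_erase (a := a) (Q := fun i p => 0 ≤ p.1 ∧ p.1 + t i ≤ 1 ∧ y ≤ p.2 ∧
        p.2 + t i ≤ 1 ∧ (x ≤ p.1 ∨ y + h ≤ p.2)) (x, y) ?_ ?_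
      · exact ⟨hx0, hfit, le_rfl, by linarith, Or.inl le_rfl⟩
      · obtain ⟨v, hv, hsep⟩ := ih (s.erase a) (x + t a) y h (by linarith) (by linarith) hy hhc hyh
          hpos' (fun i hi => (hmax' i hi).trans hah) (fun i hi => by
            nlinarith [mul_nonneg (by linarith : 0 ≤ x - h + t a)
              (sub_nonneg.2 (hmax' i hi))]) hcard
        refine ⟨v, fun i hi => ?_, hsep⟩
        obtain ⟨h1, h2, h3, h4, h5⟩ := hv i hi
        refine ⟨⟨h1, h2, h3, h4, ?_⟩, ?_⟩
        · exact h5.imp (fun h => by linarith) id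
        · exact h5.imp id (fun h => by simp only; linarith)
    · have hnew : ∑ j ∈ s.erase a, t j ^ 2 ≤ (1 - c) * (1 - (y + h) - t a) := by
        nlinarith [mul_nonneg (by linarith : 0 ≤ x + t a - 1) ha0.le,
          mul_nonneg (sub_nonneg.2 hhc) ha0.le]
      have hroom : y + h + t a ≤ 1 := by
        have := nonneg_of_mul_nonneg_right (hrest.trans hnew) (by linarith)
        linarith
      refine exists_packing_of_erase (a := a) (Q := fun i p => 0 ≤ p.1 ∧ p.1 + t i ≤ 1 ∧ y ≤ p.2 ∧
        p.2 + t i ≤ 1 ∧ (x ≤ p.1 ∨ y + h ≤ p.2)) (0, y + h) ?_ ?_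
      · exact ⟨le_rfl, by simp only; linarith, by simp only; linarith, hroom, Or.inr le_rfl⟩
      · obtain ⟨v, hv, hsep⟩ := ih (s.erase a) (t a) (y + h) (t a) le_rfl ha0.le (by linarith)
          (hah.trans hhc) hroom hpos' hmax' (fun i hi => by linarith) hcard
        refine ⟨v, fun i hi => ?_, hsep⟩
        obtain ⟨h1, h2, h3, h4, h5⟩ := hv i hi
        refine ⟨⟨h1, h2, by linarith, h4, Or.inr h3⟩, ?_⟩
        exact h5.imp (fun h => by simp only; linarith) id

theorem interior_coord_preimage (k : Fin 2) (S : Set ℝ) :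
    interior {p : Plane | p k ∈ S} = {p : Plane | p k ∈ interior S} := by
  have hopen : IsOpenMap (EuclideanSpace.proj k : Plane →L[ℝ] ℝ) :=
    ContinuousLinearMap.isOpenMap _ fun r => ⟨EuclideanSpace.single k r, by simp⟩
  exact (hopen.preimage_interior_eq_interior_preimage (ContinuousLinearMap.continuous _) S).symm

theorem disjoint_interior_of_coord_le {A B : Set Plane} (k : Fin 2) {a b : ℝ} (hab : a ≤ b)
    (hA : ∀ p ∈ A, p k ≤ a) (hB : ∀ p ∈ B, b ≤ p k) : Disjoint (interior A) (interior B) := by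
  rw [Set.disjoint_left]
  intro p hpA hpB
  have h1 : p ∈ interior {p : Plane | p k ∈ Iic a} := interior_mono hA hpA
  have h2 : p ∈ interior {p : Plane | p k ∈ Ici b} := interior_mono hB hpB
  rw [interior_coord_preimage, interior_Iic] at h1
  rw [interior_coord_preimage, interior_Ici] at h2
  exact absurd (h1.trans_le hab) (not_lt.2 (le_of_lt h2))

theorem coord_mem_of_mem_translate_stdSquare {v p : Plane} {s : ℝ}
    (hp : p ∈ (fun p => v + p) '' stdSquare s) (k : Fin 2) : v k ≤ p k ∧ p k ≤ v k + s := by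
  obtain ⟨q, ⟨⟨h1, h2⟩, h3, h4⟩, rfl⟩ := hp
  fin_cases k <;> simp <;> constructor <;> assumption

theorem refined_shelf_packing (x₁ : ℝ) (hx0 : 0 < x₁) (hx1 : x₁ < 1 / 2)
    (u : ℕ) (t : Fin u → ℝ) (htpos : ∀ i, 0 < t i) (htx : ∀ i, t i ≤ x₁)
    (harea : ∑ i, (t i) ^ 2 ≤ 1 / 2 + 2 * (x₁ - 1 / 2) ^ 2) :
    ∃ v : Fin u → Plane,
      (∀ i, (fun p => v i + p) '' stdSquare (t i) ⊆ stdRect 1 1) ∧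
      (∀ i j, i ≠ j →
        Disjoint (interior ((fun p => v i + p) '' stdSquare (t i)))
                 (interior ((fun p => v j + p) '' stdSquare (t j)))) := by
  obtain ⟨v, hv, hsep⟩ : ∃ v : Fin u → ℝ × ℝ,
      (∀ i ∈ Finset.univ, 0 ≤ (v i).1 ∧ (v i).1 + t i ≤ 1 ∧ 0 ≤ (v i).2 ∧ (v i).2 + t i ≤ 1) ∧
      ∀ i ∈ Finset.univ, ∀ j ∈ Finset.univ, i ≠ j → AxisSeparated t v i j := by
    rcases (Finset.univ : Finset (Fin u)).eq_empty_or_nonempty with hu | hu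
    · exact ⟨0, by simp [hu], by simp [hu]⟩
    obtain ⟨a, ha, hmax⟩ := Finset.exists_max_image _ t hu
    have ha0 := htpos a
    have hax := htx a
    have hsum := Finset.add_sum_erase Finset.univ (fun j => t j ^ 2) ha
    refine exists_packing_of_erase (a := a) (Q := fun i p => 0 ≤ p.1 ∧ p.1 + t i ≤ 1 ∧
      0 ≤ p.2 ∧ p.2 + t i ≤ 1) (0, 0) ?_ ?_
    · simp only
      exact ⟨le_rfl, by linarith, le_rfl, by linarith⟩
    · obtain ⟨v, hv, hsep⟩ := exists_shelf_packing t (t a) (by linarith) (Finset.univ.erase a)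
        (t a) 0 (t a) le_rfl ha0.le le_rfl le_rfl (by linarith) (fun i _ => htpos i)
        (fun i _ => hmax i (Finset.mem_univ i)) (fun i _ => by
          nlinarith [mul_nonneg (sub_nonneg.2 hax) (by linarith : 0 ≤ 1 - x₁ - t a)])
      refine ⟨v, fun i hi => ?_, hsep⟩
      obtain ⟨h1, h2, h3, h4, h5⟩ := hv i hi
      exact ⟨⟨h1, h2, h3, h4⟩, by simpa using h5⟩
  refine ⟨fun i => !₂[(v i).1, (v i).2], fun i p hp => ?_, fun i j hij => ?_⟩
  · obtain ⟨h1, h2, h3, h4⟩ := hv i (Finset.mem_univ i)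
    have c0 := coord_mem_of_mem_translate_stdSquare hp 0
    have c1 := coord_mem_of_mem_translate_stdSquare hp 1
    simp only [Matrix.cons_val_zero, Matrix.cons_val_one] at c0 c1
    exact ⟨⟨by linarith, by linarith⟩, ⟨by linarith, by linarith⟩⟩
  · rcases hsep i (Finset.mem_univ i) j (Finset.mem_univ j) hij with h | h | h | h
    · exact disjoint_interior_of_coord_le 0 h
        (fun p hp => (coord_mem_of_mem_translate_stdSquare hp 0).2)
        (fun p hp => (coord_mem_of_mem_translate_stdSquare hp 0).1)
    · exact (disjoint_interior_of_coord_le 0 h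
        (fun p hp => (coord_mem_of_mem_translate_stdSquare hp 0).2)
        (fun p hp => (coord_mem_of_mem_translate_stdSquare hp 0).1)).symm
    · exact disjoint_interior_of_coord_le 1 h
        (fun p hp => (coord_mem_of_mem_translate_stdSquare hp 1).2)
        (fun p hp => (coord_mem_of_mem_translate_stdSquare hp 1).1)
    · exact (disjoint_interior_of_coord_le 1 h
        (fun p hp => (coord_mem_of_mem_translate_stdSquare hp 1).2)
        (fun p hp => (coord_mem_of_mem_translate_stdSquare hp 1).1)).symm
end
end

section
/- Any two squares whose total area is at most 8/5 fit together in the unit disk: for all a, b > 0 with a² + b² ≤ 8/5, there exist isometries f, g of ℝ² such that f([0,a]×[0,a]) ⊆ D, g([0,b]×[0,b]) ⊆ D, and the interiors of f([0,a]×[0,a]) and g([0,b]×[0,b]) are disjoint. -/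
noncomputable section
open Set Metric

/-- The tangent-line bound, at `x ^ 2 = 4 / 5`, for the convex function
`u ↦ √(1 - u / 4) - √u`. -/
lemma tangent_le_sqrt (x : ℝ) (hx : 0 ≤ x) (hx2 : x ^ 2 ≤ 8 / 5) :
    x + 25 * √(4 / 5) / 32 * (4 / 5 - x ^ 2) ≤ √(1 - x ^ 2 / 4) := by
  have hs : √(4 / 5 : ℝ) ^ 2 = 4 / 5 := Real.sq_sqrt (by norm_num)
  have hs0 : 0 < √(4 / 5 : ℝ) := by positivity
  generalize √(4 / 5 : ℝ) = s at hs hs0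
  obtain ⟨y, rfl⟩ : ∃ y, x = s * y := ⟨x / s, by field_simp⟩
  have hy : 0 ≤ y := nonneg_of_mul_nonneg_right hx hs0
  have e : (s * y) ^ 2 = 4 / 5 * y ^ 2 := by rw [mul_pow, hs]
  rw [e] at hx2 ⊢
  apply Real.le_sqrt_of_sq_le
  have e' : (s * y + 25 * s / 32 * (4 / 5 - 4 / 5 * y ^ 2)) ^ 2
      = 4 / 5 * (y + 5 / 8 * (1 - y ^ 2)) ^ 2 := by
    linear_combination (y + 5 / 8 * (1 - y ^ 2)) ^ 2 * hs
  rw [e']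
  have h : 0 ≤ (y - 1) ^ 2 * (11 + 6 * y - 5 * y ^ 2) :=
    mul_nonneg (sq_nonneg _) (by linarith)
  linarith

lemma add_le_sqrt_add_sqrt (a b : ℝ) (ha : 0 ≤ a) (hb : 0 ≤ b)
    (h : a ^ 2 + b ^ 2 ≤ 8 / 5) :
    a + b ≤ √(1 - a ^ 2 / 4) + √(1 - b ^ 2 / 4) := by
  have h1 := tangent_le_sqrt a ha (by nlinarith [sq_nonneg b])
  have h2 := tangent_le_sqrt b hb (by nlinarith [sq_nonneg a])
  have h3 : 0 ≤ 25 * √(4 / 5) / 32 * (8 / 5 - (a ^ 2 + b ^ 2)) :=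
    mul_nonneg (by positivity) (by linarith)
  linarith

/-- The translation moving the midpoint of the left edge of `stdSquare s` to `(x, 0)`. -/
def centeredShift (s x : ℝ) : Plane ≃ᵢ Plane := IsometryEquiv.addRight !₂[x, -(s / 2)]

lemma centeredShift_apply_zero (s x : ℝ) (p : Plane) : centeredShift s x p 0 = p 0 + x := by
  simp [centeredShift]

lemma centeredShift_apply_one (s x : ℝ) (p : Plane) :
    centeredShift s x p 1 = p 1 - s / 2 := by
  simp [centeredShift, sub_eq_add_neg]

lemma centeredShift_image_subset_unitDisk (s x : ℝ) (hs : s ^ 2 / 4 ≤ 1)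
    (hl : -√(1 - s ^ 2 / 4) ≤ x) (hr : x + s ≤ √(1 - s ^ 2 / 4)) :
    centeredShift s x '' stdSquare s ⊆ unitDisk := by
  rintro _ ⟨p, ⟨⟨h1, h2⟩, h3, h4⟩, rfl⟩
  have hq := Real.sq_sqrt (sub_nonneg.2 hs)
  rw [unitDisk, mem_closedBall_zero_iff, EuclideanSpace.norm_eq, Real.sqrt_le_iff, one_pow,
    Fin.sum_univ_two, Real.norm_eq_abs, Real.norm_eq_abs, sq_abs, sq_abs,
    centeredShift_apply_zero, centeredShift_apply_one]
  refine ⟨zero_le_one, ?_⟩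
  have i0 : (p 0 + x) ^ 2 ≤ √(1 - s ^ 2 / 4) ^ 2 :=
    sq_le_sq' (by linarith) (by linarith)
  have i1 : (p 1 - s / 2) ^ 2 ≤ (s / 2) ^ 2 := sq_le_sq' (by linarith) (by linarith)
  linarith

lemma disjoint_interior_of_separated (A B : Set Plane) (t : ℝ)
    (hA : ∀ p ∈ A, p 0 ≤ t) (hB : ∀ p ∈ B, t ≤ p 0) :
    Disjoint (interior A) (interior B) := by
  have hopen : IsOpenMap (EuclideanSpace.proj 0 : Plane →L[ℝ] ℝ) :=
    ContinuousLinearMap.isOpenMap _ fun r => ⟨!₂[r, 0], by simp⟩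
  have hA' : A ⊆ (EuclideanSpace.proj 0 : Plane →L[ℝ] ℝ) ⁻¹' Iic t := hA
  have h1 : interior A ⊆ (EuclideanSpace.proj 0 : Plane →L[ℝ] ℝ) ⁻¹' Iio t := by
    rw [← interior_Iic]
    exact (interior_mono hA').trans hopen.interior_preimage_subset_preimage_interior
  refine Set.disjoint_left.2 fun p hp hp' => ?_
  exact (h1 hp).not_ge (hB p (interior_subset hp'))

lemma two_squares_pack_of_le (a b : ℝ) (hb : 0 < b) (hba : b ≤ a)
    (harea : a ^ 2 + b ^ 2 ≤ 8 / 5) :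
    ∃ f g : Plane ≃ᵢ Plane,
      f '' stdSquare a ⊆ unitDisk ∧ g '' stdSquare b ⊆ unitDisk ∧
      Disjoint (interior (f '' stdSquare a)) (interior (g '' stdSquare b)) := by
  have hsq : b ^ 2 ≤ a ^ 2 := pow_le_pow_left₀ hb.le hba 2
  have hb2 := sq_nonneg b
  have hsum := add_le_sqrt_add_sqrt a b (hb.le.trans hba) hb.le harea
  have hmono : √(1 - a ^ 2 / 4) ≤ √(1 - b ^ 2 / 4) := Real.sqrt_le_sqrt (by linarith)
  have ha2 : a / 2 ≤ √(1 - a ^ 2 / 4) := Real.le_sqrt_of_sq_le (by linarith)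
  refine ⟨centeredShift a (-√(1 - a ^ 2 / 4)), centeredShift b (a - √(1 - a ^ 2 / 4)),
    centeredShift_image_subset_unitDisk _ _ (by linarith) le_rfl (by linarith),
    centeredShift_image_subset_unitDisk _ _ (by linarith) (by linarith) (by linarith),
    disjoint_interior_of_separated _ _ (a - √(1 - a ^ 2 / 4)) ?_ ?_⟩
  · rintro _ ⟨p, ⟨⟨-, h⟩, -⟩, rfl⟩
    rw [centeredShift_apply_zero]
    linarith
  · rintro _ ⟨p, ⟨⟨h, -⟩, -⟩, rfl⟩
    rw [centeredShift_apply_zero]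
    linarith

theorem two_squares_pack (a b : ℝ) (ha : 0 < a) (hb : 0 < b)
    (harea : a ^ 2 + b ^ 2 ≤ 8 / 5) :
    ∃ f g : Plane ≃ᵢ Plane,
      f '' stdSquare a ⊆ unitDisk ∧ g '' stdSquare b ⊆ unitDisk ∧
      Disjoint (interior (f '' stdSquare a)) (interior (g '' stdSquare b)) := by
  rcases le_total b a with h | h
  · exact two_squares_pack_of_le a b hb h harea
  · obtain ⟨f, g, hf, hg, hd⟩ := two_squares_pack_of_le b a ha h (by linarith)
    exact ⟨g, f, hg, hf, hd.symm⟩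
end
end

section
/- For every z with 0 < z ≤ 3/5, setting t := √(1 − z²/4) − z and θ := arccos(t), the area of the circular segment of the unit disk cut off below the chord at height t is strictly less than the area of the rectangle of width 2·sin(θ) and height z: θ − sin(θ)·cos(θ) < 2·z·sin(θ). -/
/-- An upper bound for the angle `x ∈ [0, arccos (1 / 3)]` in terms of its sine and cosine. -/
theorem le_sin_mul_of_one_third_le_cos {x : ℝ} (hx0 : 0 ≤ x) (hxpi : x ≤ Real.pi)
    (hx : 1 / 3 ≤ Real.cos x) :
    x ≤ Real.sin x * (8 / 5 - 3 / 5 * Real.cos x) := by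
  have hderiv : ∀ y : ℝ,
      HasDerivAt (fun y => Real.sin y * (8 / 5 - 3 / 5 * Real.cos y) - y)
        (2 / 5 * (1 - Real.cos y) * (3 * Real.cos y - 1)) y := by
    intro y
    have h := ((Real.hasDerivAt_sin y).mul
      (((Real.hasDerivAt_cos y).const_mul (3 / 5)).const_sub (8 / 5))).sub (hasDerivAt_id y)
    refine h.congr_deriv ?_
    linear_combination (3 / 5) * Real.sin_sq_add_cos_sq y
  have hmono : MonotoneOn (fun y => Real.sin y * (8 / 5 - 3 / 5 * Real.cos y) - y)
      (Set.Icc 0 x) := by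
    refine monotoneOn_of_deriv_nonneg (convex_Icc 0 x)
      (fun y _ => (hderiv y).continuousAt.continuousWithinAt)
      (fun y _ => (hderiv y).differentiableAt.differentiableWithinAt) ?_
    intro y hy
    rw [interior_Icc] at hy
    rw [(hderiv y).deriv]
    have h1 : Real.cos x ≤ Real.cos y :=
      Real.cos_le_cos_of_nonneg_of_le_pi hy.1.le hxpi hy.2.le
    have h2 := Real.cos_le_one y
    exact mul_nonneg (by linarith) (by linarith)
  have h := hmono (Set.left_mem_Icc.2 hx0) (Set.right_mem_Icc.2 hx0) hx0
  simp only [Real.sin_zero, zero_mul, sub_zero] at h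
  linarith

theorem segment_area_lt_rectangle (z : ℝ) (hz0 : 0 < z) (hz1 : z ≤ 3 / 5) :
    Real.arccos (Real.sqrt (1 - z ^ 2 / 4) - z) -
      Real.sin (Real.arccos (Real.sqrt (1 - z ^ 2 / 4) - z)) *
        Real.cos (Real.arccos (Real.sqrt (1 - z ^ 2 / 4) - z)) <
    2 * z * Real.sin (Real.arccos (Real.sqrt (1 - z ^ 2 / 4) - z)) := by
  have hle : Real.sqrt (1 - z ^ 2 / 4) ≤ 1 := Real.sqrt_le_one.2 (by nlinarith)
  have hlower : 1 - z / 4 < Real.sqrt (1 - z ^ 2 / 4) :=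
    Real.lt_sqrt_of_sq_lt (by nlinarith)
  have hthird : z + 1 / 3 < Real.sqrt (1 - z ^ 2 / 4) :=
    Real.lt_sqrt_of_sq_lt (by nlinarith)
  set t := Real.sqrt (1 - z ^ 2 / 4) - z with ht
  have hcos : Real.cos (Real.arccos t) = t := Real.cos_arccos (by linarith) (by linarith)
  have hsin : 0 < Real.sin (Real.arccos t) := by
    rw [Real.sin_arccos]
    exact Real.sqrt_pos.2 (by nlinarith)
  have hangle := le_sin_mul_of_one_third_le_cos (Real.arccos_nonneg t) (Real.arccos_le_pi t)
    (by rw [hcos]; linarith)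
  rw [hcos] at hangle ⊢
  have hz : 0 < 2 * z - 8 / 5 * (1 - t) := by linarith
  linarith [mul_pos hsin hz]
end

section
/- For every θ with 0 ≤ θ ≤ arccos(1/3), the inequality (8/5)·sin(θ) − (3/5)·sin(θ)·cos(θ) − θ ≥ 0 holds. -/
theorem segment_area_inequality (θ : ℝ) (h0 : 0 ≤ θ) (h1 : θ ≤ Real.arccos (1 / 3)) :
    8 / 5 * Real.sin θ - 3 / 5 * Real.sin θ * Real.cos θ - θ ≥ 0 := by
  have hderiv (x : ℝ) : HasDerivAt
      (fun x ↦ 8 / 5 * Real.sin x - 3 / 5 * Real.sin x * Real.cos x - x)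
      (2 / 5 * (3 * Real.cos x - 1) * (1 - Real.cos x)) x := by
    have h := (((Real.hasDerivAt_sin x).const_mul (8 / 5)).sub
      (((Real.hasDerivAt_sin x).const_mul (3 / 5)).mul (Real.hasDerivAt_cos x))).sub
      (hasDerivAt_id x)
    refine h.congr_deriv ?_
    linear_combination (3 / 5) * Real.sin_sq_add_cos_sq x
  have hmono : MonotoneOn
      (fun x ↦ 8 / 5 * Real.sin x - 3 / 5 * Real.sin x * Real.cos x - x)
      (Set.Icc 0 (Real.arccos (1 / 3))) := by
    refine monotoneOn_of_hasDerivWithinAt_nonneg (convex_Icc _ _)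
      (fun x _ ↦ (hderiv x).continuousAt.continuousWithinAt)
      (fun x _ ↦ (hderiv x).hasDerivWithinAt) fun x hx ↦ ?_
    obtain ⟨hx0, hx1⟩ := interior_subset hx
    have hcos := Real.cos_le_cos_of_nonneg_of_le_pi hx0 (Real.arccos_le_pi _) hx1
    rw [Real.cos_arccos (by norm_num) (by norm_num)] at hcos
    exact mul_nonneg (by linarith) (by linarith [Real.cos_le_one x])
  simpa using hmono ⟨le_rfl, Real.arccos_nonneg _⟩ ⟨h0, h1⟩ h0
end
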